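/- arXiv:2410.17057 — 6 statements merged into one kernel-verified Lean document; each statement's English description precedes it below -/
import Mathlib

section
/- For every n ≥ 0, the number of permutations of length n avoiding the classical patterns 132, 3214, and 4213 is 2^n − n; that is, |Av_n(132, 3214, 4213)| = 2^n − n. -/
/-- `τ` contains the vincular pattern with entries `σ` and adjacency-constraint set `A`:
there is an occurrence of the classical pattern `σ` in `τ` (a strictly increasing choice of
positions carrying entries order-isomorphic to `σ`) such that for every `a ∈ A`, the
occurrence positions corresponding to entries `a` and `a + 1` of `σ` are adjacent in `τ`.
Classical patterns correspond to `A = ∅`. -/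
def ContainsV (σ : List ℕ) (A : Set ℕ) (τ : List ℕ) : Prop :=
  ∃ f : Fin σ.length → Fin τ.length,
    StrictMono f ∧
    (∀ a b : Fin σ.length, σ.get a < σ.get b ↔ τ.get (f a) < τ.get (f b)) ∧
    ∀ a : ℕ, a ∈ A → ∀ h : a + 1 < σ.length,
      (f ⟨a + 1, h⟩ : ℕ) = (f ⟨a, Nat.lt_of_succ_lt h⟩ : ℕ) + 1

open Classical in
/-- The `σ`-avoiding stack pass: `scAux σ A stack input` where the stack is recorded
top-to-bottom; the next input element is pushed when the stack contents together with the
new element on top avoid the vincular pattern `(σ, A)`, and otherwise the top of the stack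
is popped to the output; at the end the remaining stack entries are popped to the output. -/
noncomputable def scAux (σ : List ℕ) (A : Set ℕ) : List ℕ → List ℕ → List ℕ
  | stack, [] => stack
  | [], x :: rest => scAux σ A [x] rest
  | y :: stack', x :: rest =>
    if ContainsV σ A (x :: y :: stack') then
      y :: scAux σ A stack' (x :: rest)
    else
      scAux σ A (x :: y :: stack') rest
termination_by stack input => stack.length + 2 * input.length
decreasing_by all_goals (simp only [List.length_cons, List.length_nil]; omega)

/-- The `(σ, A)`-avoiding stack-sorting map `sc_{(σ, A)}`. -/
noncomputable def sc (σ : List ℕ) (A : Set ℕ) (τ : List ℕ) : List ℕ :=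
  scAux σ A [] τ

/-- `τ` is (the one-line notation of) a permutation of `{1, …, n}`. -/
def IsPermList (n : ℕ) (τ : List ℕ) : Prop :=
  τ.Perm (List.range' 1 n)

/-- The sorting class `Sort_n(sc_{(σ, A)})`: permutations of length `n` whose image under
`sc_{(σ, A)}` avoids the classical pattern `231`. -/
def SortSet (σ : List ℕ) (A : Set ℕ) (n : ℕ) : Set (List ℕ) :=
  {τ | IsPermList n τ ∧ ¬ ContainsV [2, 3, 1] ∅ (sc σ A τ)}

namespace AvCount

def N2 (l : List ℕ) : Prop := ∀ a b, List.Sublist [a, b] l → ¬ b < a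
def N132 (l : List ℕ) : Prop := ∀ a b c, List.Sublist [a, b, c] l → ¬ (a < c ∧ c < b)
def N213 (l : List ℕ) : Prop := ∀ a b c, List.Sublist [a, b, c] l → ¬ (b < a ∧ a < c)
def N321 (l : List ℕ) : Prop := ∀ a b c, List.Sublist [a, b, c] l → ¬ (c < b ∧ b < a)
def N3214 (l : List ℕ) : Prop :=
  ∀ a b c d, List.Sublist [a, b, c, d] l → ¬ (c < b ∧ b < a ∧ a < d)
def N4213 (l : List ℕ) : Prop :=
  ∀ a b c d, List.Sublist [a, b, c, d] l → ¬ (c < b ∧ b < d ∧ d < a)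

lemma sub1 (a : ℕ) (M : List ℕ) : List.Sublist [a] M ↔ a ∈ M := List.singleton_sublist

lemma subc (a x : ℕ) (l M : List ℕ) :
    List.Sublist (a :: l) (x :: M) ↔ List.Sublist (a :: l) M ∨ (a = x ∧ List.Sublist l M) := by
  rw [List.sublist_cons_iff]; simp

lemma suba (a : ℕ) (l L M : List ℕ) :
    List.Sublist (a :: l) (L ++ M) ↔
      List.Sublist (a :: l) M ∨ ∃ l1 l2, l = l1 ++ l2 ∧ List.Sublist (a :: l1) L ∧
        List.Sublist l2 M := by
  rw [List.sublist_append_iff]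
  constructor
  · rintro ⟨l1, l2, h, h1, h2⟩
    cases l1 with
    | nil => left; simp at h; rwa [h]
    | cons b l1 =>
      simp at h
      right; exact ⟨l1, l2, h.2, h.1 ▸ h1, h2⟩
  · rintro (h | ⟨l1, l2, h, h1, h2⟩)
    · exact ⟨[], a :: l, rfl, by simp, h⟩
    · exact ⟨a :: l1, l2, by simp [h], h1, h2⟩

lemma sub2a (a b : ℕ) (L M : List ℕ) : List.Sublist [a, b] (L ++ M) ↔
    List.Sublist [a, b] L ∨ (a ∈ L ∧ b ∈ M) ∨ List.Sublist [a, b] M := by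
  rw [suba]
  simp only [List.cons_eq_append_iff, List.nil_eq_append_iff]
  constructor
  · rintro (h | ⟨l1, l2, (⟨rfl, rfl⟩ | ⟨_, rfl, rfl, rfl⟩), h1, h2⟩) <;> simp_all
  · rintro (h | ⟨h, h'⟩ | h)
    · exact Or.inr ⟨[b], [], by simp [h]⟩
    · exact Or.inr ⟨[], [b], by simp [h, h']⟩
    · exact Or.inl h

lemma sub3a (a b c : ℕ) (L M : List ℕ) : List.Sublist [a, b, c] (L ++ M) ↔
    List.Sublist [a, b, c] L ∨ (List.Sublist [a, b] L ∧ c ∈ M) ∨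
      (a ∈ L ∧ List.Sublist [b, c] M) ∨ List.Sublist [a, b, c] M := by
  rw [suba]
  constructor
  · rintro (h | ⟨l1, l2, h, h1, h2⟩)
    · simp [h]
    · rcases l1 with _ | ⟨p, _ | ⟨q, l1⟩⟩ <;> simp at h
      · subst h; simp_all
      · obtain ⟨rfl, rfl⟩ := h; simp_all
      · simp_all
  · rintro (h | ⟨h, h'⟩ | ⟨h, h'⟩ | h)
    · exact Or.inr ⟨[b, c], [], by simp [h]⟩
    · exact Or.inr ⟨[b], [c], by simp [h, h']⟩
    · exact Or.inr ⟨[], [b, c], by simp [h, h']⟩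
    · exact Or.inl h

lemma sub4a (a b c d : ℕ) (L M : List ℕ) : List.Sublist [a, b, c, d] (L ++ M) ↔
    List.Sublist [a, b, c, d] L ∨ (List.Sublist [a, b, c] L ∧ d ∈ M) ∨
    (List.Sublist [a, b] L ∧ List.Sublist [c, d] M) ∨
      (a ∈ L ∧ List.Sublist [b, c, d] M) ∨ List.Sublist [a, b, c, d] M := by
  rw [suba]
  constructor
  · rintro (h | ⟨l1, l2, h, h1, h2⟩)
    · simp [h]
    · rcases l1 with _ | ⟨p, _ | ⟨q, _ | ⟨r, l1⟩⟩⟩ <;> simp at h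
      · subst h; simp_all
      · obtain ⟨rfl, rfl⟩ := h; simp_all
      · obtain ⟨rfl, rfl, rfl⟩ := h; simp_all
      · simp_all
  · rintro (h | ⟨h, h'⟩ | ⟨h, h'⟩ | ⟨h, h'⟩ | h)
    · exact Or.inr ⟨[b, c, d], [], by simp [h]⟩
    · exact Or.inr ⟨[b, c], [d], by simp [h, h']⟩
    · exact Or.inr ⟨[b], [c, d], by simp [h, h']⟩
    · exact Or.inr ⟨[], [b, c, d], by simp [h, h']⟩
    · exact Or.inl h

lemma mem2 {a b : ℕ} {L : List ℕ} (h : List.Sublist [a, b] L) : a ∈ L ∧ b ∈ L :=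
  ⟨h.subset (by simp), h.subset (by simp)⟩
lemma mem3 {a b c : ℕ} {L : List ℕ} (h : List.Sublist [a, b, c] L) :
    a ∈ L ∧ b ∈ L ∧ c ∈ L ∧ List.Sublist [a, b] L ∧ List.Sublist [b, c] L :=
  ⟨h.subset (by simp), h.subset (by simp), h.subset (by simp),
    List.Sublist.trans (by simp) h, List.Sublist.trans (by simp) h⟩
lemma mem4 {a b c d : ℕ} {L : List ℕ} (h : List.Sublist [a, b, c, d] L) :
    a ∈ L ∧ b ∈ L ∧ c ∈ L ∧ d ∈ L ∧ List.Sublist [a, b, c] L ∧ List.Sublist [b, c, d] L :=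
  ⟨h.subset (by simp), h.subset (by simp), h.subset (by simp), h.subset (by simp),
    List.Sublist.trans (by simp) h, List.Sublist.trans (by simp) h⟩

def Sep (L : List ℕ) (x : ℕ) (R : List ℕ) : Prop :=
  (∀ a ∈ L, a < x) ∧ (∀ b ∈ R, b < x) ∧ ∀ a ∈ L, ∀ b ∈ R, b < a

lemma N132_iff {L : List ℕ} {x : ℕ} {R : List ℕ} (h : Sep L x R) :
    N132 (L ++ x :: R) ↔ N132 L ∧ N132 R := by
  obtain ⟨h1, h2, h3⟩ := h
  unfold N132
  simp only [sub3a, subc, sub1, List.mem_cons]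
  have := @mem2
  have := @mem3
  constructor
  · grind
  · rintro ⟨hL, hR⟩ a b c h
    grind

lemma N213_iff {L : List ℕ} {x : ℕ} {R : List ℕ} (h : Sep L x R) :
    N213 (L ++ x :: R) ↔ N2 L ∧ N213 R := by
  obtain ⟨h1, h2, h3⟩ := h
  unfold N213 N2
  simp only [sub3a, subc, sub1, List.mem_cons]
  have := @mem2
  have := @mem3
  constructor
  · intro H
    refine ⟨fun a b hab hlt => H a b x ?_ ⟨hlt, h1 _ (mem2 hab).1⟩, ?_⟩ <;> grind
  · rintro ⟨hL, hR⟩ a b c h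
    grind

lemma N2_iff {L : List ℕ} {x : ℕ} {R : List ℕ} (h : Sep L x R) :
    N2 (L ++ x :: R) ↔ N2 L ∧ R = [] := by
  obtain ⟨h1, h2, h3⟩ := h
  unfold N2
  simp only [sub2a, subc, sub1, List.mem_cons]
  have := @mem2
  constructor
  · intro H
    refine ⟨by grind, ?_⟩
    rcases R with _ | ⟨r, R⟩
    · rfl
    · exact absurd (h2 r (by simp)) (H x r (by simp))
  · rintro ⟨hL, rfl⟩ a b h
    simp at h
    grind

lemma N321_iff {L : List ℕ} {x : ℕ} {R : List ℕ} (h : Sep L x R) :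
    N321 (L ++ x :: R) ↔ (if R.length = 0 then N321 L else N2 L) ∧ N2 R := by
  obtain ⟨h1, h2, h3⟩ := h
  unfold N321 N2
  simp only [sub3a, subc, sub1, List.mem_cons]
  have := @mem2
  have := @mem3
  rcases R with _ | ⟨r, R⟩
  · simp
    grind
  · simp only [List.length_cons, Nat.add_eq_zero_iff, one_ne_zero, and_false, if_false]
    constructor
    · intro H
      refine ⟨fun a b hab hlt => H a b r ?_ ⟨h3 _ (mem2 hab).2 _ (by simp), hlt⟩,
        fun b c hbc hlt => H x b c ?_ ⟨hlt, h2 _ (mem2 hbc).1⟩⟩ <;> grind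
    · rintro ⟨hL, hR⟩ a b c h
      have := @mem2 b c (r :: R)
      have := @mem3 a b c (r :: R)
      grind

lemma NA_iff {L : List ℕ} {x : ℕ} {R : List ℕ} (h : Sep L x R) :
    (N3214 (L ++ x :: R) ∧ N4213 (L ++ x :: R)) ↔ N321 L ∧ N213 R := by
  obtain ⟨h1, h2, h3⟩ := h
  unfold N321 N213 N3214 N4213
  simp only [sub4a, subc, sub1, List.mem_cons]
  have := @mem2
  have := @mem3
  have := @mem4
  constructor
  · rintro ⟨H1, H2⟩
    refine ⟨fun a b c hab hlt => H1 a b c x ?_ ⟨hlt.1, hlt.2, h1 _ (mem3 hab).1⟩,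
      fun a b c hab hlt => H2 x a b c ?_ ⟨hlt.1, hlt.2, h2 _ (mem3 hab).2.2.1⟩⟩ <;> grind
  · rintro ⟨hL, hR⟩
    constructor <;> intro a b c d h <;> grind

open Classical in
noncomputable def S (Q : List ℕ → Prop) (s n : ℕ) : Finset (List ℕ) :=
  (List.range' s n).permutations.toFinset.filter (fun τ => N132 τ ∧ Q τ)

lemma mem_S {Q : List ℕ → Prop} {s n : ℕ} {τ : List ℕ} :
    τ ∈ S Q s n ↔ τ.Perm (List.range' s n) ∧ N132 τ ∧ Q τ := by
  simp [S]

lemma split_perm {L R : List ℕ} {s n : ℕ} (h : (L ++ R).Perm (List.range' s n))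
    (hs : ∀ a ∈ L, ∀ b ∈ R, b < a) :
    R.Perm (List.range' s R.length) ∧ L.Perm (List.range' (s + R.length) (n - R.length)) := by
  have hlen := h.length_eq
  simp at hlen
  have e : R.mergeSort ++ L.mergeSort = List.range' s n := by
    apply List.Perm.eq_of_pairwise (le := (· ≤ ·))
    · intro a b _ _ h1 h2; exact le_antisymm h1 h2
    · rw [List.pairwise_append]
      refine ⟨?_, ?_, ?_⟩
      · simpa using List.pairwise_mergeSort' (· ≤ ·) R
      · simpa using List.pairwise_mergeSort' (· ≤ ·) L
      · intro b hb a ha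
        simp at hb ha
        exact (hs a ha b hb).le
    · exact (List.pairwise_lt_range').imp le_of_lt
    · exact (((List.mergeSort_perm _ _).append (List.mergeSort_perm _ _)).trans
        List.perm_append_comm).trans h
  have e2 : List.range' s n = List.range' s R.length ++
      List.range' (s + R.length) (n - R.length) := by
    rw [List.range'_append_1]; congr 1; omega
  rw [e2] at e
  obtain ⟨e3, e4⟩ := List.append_inj e (by simp)
  exact ⟨e3 ▸ (List.mergeSort_perm _ _).symm, e4 ▸ (List.mergeSort_perm _ _).symm⟩

lemma card_rec {Q QR : List ℕ → Prop} {QL : ℕ → List ℕ → Prop}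
    (h : ∀ L x R, Sep L x R → (Q (L ++ x :: R) ↔ QL R.length L ∧ QR R)) (s n : ℕ) :
    (S Q s (n + 1)).card =
      ∑ m ∈ Finset.range (n + 1), (S (QL m) (s + m) (n - m)).card * (S QR s m).card := by
  simp only [← Finset.card_product]
  rw [← Finset.card_sigma]
  symm
  have key : ∀ m L R, m ≤ n → L.Perm (List.range' (s + m) (n - m)) → R.Perm (List.range' s m) →
      Sep L (s + n) R := by
    intro m L R hm hL hR
    refine ⟨fun a ha => ?_, fun b hb => ?_, fun a ha b hb => ?_⟩
    · have := hL.mem_iff.1 ha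
      simp only [List.mem_range'_1] at this; omega
    · have := hR.mem_iff.1 hb
      simp only [List.mem_range'_1] at this; omega
    · have := hL.mem_iff.1 ha
      have := hR.mem_iff.1 hb
      simp only [List.mem_range'_1] at *; omega
  apply Finset.card_bij (fun p _ => p.2.1 ++ (s + n) :: p.2.2)
  · rintro ⟨m, L, R⟩ hp
    simp only [Finset.mem_sigma, Finset.mem_range, Finset.mem_product, mem_S] at hp ⊢
    obtain ⟨hm, ⟨hL, hL1, hL2⟩, hR, hR1, hR2⟩ := hp
    have sep := key m L R (by omega) hL hR
    have hl : R.length = m := by simpa using hR.length_eq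
    rw [N132_iff sep, h _ _ _ sep, hl]
    refine ⟨?_, ⟨hL1, hR1⟩, hL2, hR2⟩
    have e2 : List.range' s (n + 1) = (List.range' s m ++
      List.range' (s + m) (n - m)) ++ [s + n] := by
      rw [List.range'_append_1, List.range'_1_concat]; congr 3; omega
    rw [e2]
    refine List.perm_middle.trans (List.Perm.trans ?_ List.perm_append_comm)
    refine List.Perm.cons _ (List.perm_append_comm.trans (hR.append hL))
  · rintro ⟨m, L, R⟩ hp ⟨m', L', R'⟩ hp' e
    simp only [Finset.mem_sigma, Finset.mem_range, Finset.mem_product, mem_S] at hp hp' e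
    have sep := key m L R (by omega) hp.2.1.1 hp.2.2.1
    have sep' := key m' L' R' (by omega) hp'.2.1.1 hp'.2.2.1
    have hl : R.length = m := by simpa using hp.2.2.1.length_eq
    have hl' : R'.length = m' := by simpa using hp'.2.2.1.length_eq
    have n1 : s + n ∉ L := fun hh => lt_irrefl _ (sep.1 _ hh)
    have n2 : s + n ∉ R := fun hh => lt_irrefl _ (sep.2.1 _ hh)
    have n3 : s + n ∉ L' := fun hh => lt_irrefl _ (sep'.1 _ hh)
    have n4 : s + n ∉ R' := fun hh => lt_irrefl _ (sep'.2.1 _ hh)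
    have : L = L' ∧ R = R' := by
      rcases List.append_eq_append_iff.1 e with ⟨t, h1, h2⟩ | ⟨t, h1, h2⟩ <;>
        rcases t with _ | ⟨y, t⟩ <;> simp_all
    obtain ⟨rfl, rfl⟩ := this
    subst hl; subst hl'; rfl
  · intro τ hτ
    rw [mem_S] at hτ
    obtain ⟨hp, h1, h2⟩ := hτ
    have hx : s + n ∈ τ := by rw [hp.mem_iff, List.mem_range'_1]; omega
    obtain ⟨L, R, rfl⟩ := List.append_of_mem hx
    have nd : (L ++ (s + n) :: R).Nodup := hp.nodup_iff.2 List.nodup_range'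
    have hp2 : (L ++ R).Perm (List.range' s n) := by
      rw [List.range'_1_concat] at hp
      exact ((List.perm_middle.symm.trans hp).trans List.perm_append_comm).cons_inv
    have lt : ∀ a ∈ L ++ R, a < s + n := by
      intro a ha
      have := hp2.mem_iff.1 ha
      rw [List.mem_range'_1] at this; omega
    have hLR : ∀ a ∈ L, ∀ b ∈ R, b < a := by
      intro a ha b hb
      have hne : a ≠ b := by
        rintro rfl
        have := (List.nodup_append.1 nd).2.2 a ha a (by simp [hb])
        exact this rfl
      by_contra hlt
      refine h1 a (s + n) b ?_ ⟨by omega, lt b (by simp [hb])⟩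
      rw [sub3a]
      simp [ha, hb]
    have sep : Sep L (s + n) R :=
      ⟨fun a ha => lt a (by simp [ha]), fun a ha => lt a (by simp [ha]), hLR⟩
    rw [N132_iff sep] at h1
    rw [h _ _ _ sep] at h2
    have hlen := hp2.length_eq
    simp at hlen
    obtain ⟨hR, hL⟩ := split_perm hp2 hLR
    refine ⟨⟨R.length, L, R⟩, ?_, rfl⟩
    simp only [Finset.mem_sigma, Finset.mem_range, Finset.mem_product, mem_S]
    exact ⟨by omega, ⟨hL, h1.1, h2.1⟩, hR, h1.2, h2.2⟩

lemma card_zero {Q : List ℕ → Prop} (h : Q []) (s : ℕ) : (S Q s 0).card = 1 := by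
  have : S Q s 0 = {[]} := by
    ext τ
    rw [mem_S]
    simp only [List.range'_zero, List.perm_nil, Finset.mem_singleton]
    constructor
    · exact fun h => h.1
    · rintro rfl; exact ⟨rfl, by simp [N132], h⟩
  simp [this]

lemma card_N2 (n : ℕ) : ∀ s, (S N2 s n).card = 1 := by
  induction n with
  | zero => exact card_zero (by simp [N2])
  | succ n ih =>
    intro s
    rw [card_rec (QL := fun _ => N2) (QR := fun l => l = []) (fun L x R h => N2_iff h),
      Finset.sum_range_succ', Finset.sum_eq_zero]
    · simp [ih, card_zero]
    · intro m _
      have : S (fun l => l = []) s (m + 1) = ∅ := by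
        ext τ
        rw [mem_S]
        simp only [Finset.notMem_empty, iff_false]
        rintro ⟨h, _, rfl⟩
        simpa using h.length_eq
      simp [this]

lemma card_N213_sum (s n : ℕ) : (S N213 s (n + 1)).card =
    ∑ m ∈ Finset.range (n + 1), (S N213 s m).card := by
  rw [card_rec (QL := fun _ => N2) (QR := N213) (fun L x R h => N213_iff h)]
  simp [card_N2]

lemma card_N213 (s n : ℕ) : (S N213 s (n + 1)).card = 2 ^ n := by
  induction n with
  | zero => rw [card_N213_sum]; simp; exact card_zero (by simp [N213]) s
  | succ n ih =>
    rw [card_N213_sum, Finset.sum_range_succ, ← card_N213_sum, ih]; ring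

lemma card_N321 (n : ℕ) : ∀ s, (S N321 s n).card = n.choose 2 + 1 := by
  induction n with
  | zero => intro s; rw [card_zero (by simp [N321])]; simp
  | succ n ih =>
    intro s
    rw [card_rec (QL := fun m l => if m = 0 then N321 l else N2 l) (QR := N2)
      (fun L x R h => N321_iff h), Finset.sum_range_succ']
    simp [ih, card_N2, Nat.choose_succ_succ]
    ring

lemma conv_sum (n : ℕ) : (∑ m ∈ Finset.range n, ((n - 1 - m).choose 2 + 1) * 2 ^ m)
    + (n.choose 2 + 1) + (n + 1) = 2 ^ (n + 1) := by
  induction n with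
  | zero => simp
  | succ n ih =>
    rw [Finset.sum_range_succ']
    have : ∀ m ∈ Finset.range n, ((n + 1 - 1 - (m + 1)).choose 2 + 1) * 2 ^ (m + 1)
        = 2 * (((n - 1 - m).choose 2 + 1) * 2 ^ m) := by
      intro m _
      rw [show n + 1 - 1 - (m + 1) = n - 1 - m by omega]; ring
    rw [Finset.sum_congr rfl this, ← Finset.mul_sum, pow_succ, ← ih]
    simp [Nat.choose_succ_succ]
    ring

lemma card_A (s n : ℕ) : (S (fun l => N3214 l ∧ N4213 l) s n).card = 2 ^ n - n := by
  cases n with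
  | zero => rw [card_zero (by simp [N3214, N4213])]; simp
  | succ n =>
    rw [card_rec (QL := fun _ => N321) (QR := N213) (fun L x R h => NA_iff h),
      Finset.sum_range_succ']
    simp only [card_N321, card_N213]
    rw [card_zero (by simp [N213]), ← conv_sum n]
    simp only [Nat.sub_zero, mul_one, Nat.add_sub_cancel]
    congr 1
    refine Finset.sum_congr rfl fun m _ => ?_
    rw [show n - (m + 1) = n - 1 - m by omega]

lemma contains_iff (σ τ : List ℕ) : ContainsV σ ∅ τ ↔
    ∃ l : List ℕ, List.Sublist l τ ∧ ∃ e : l.length = σ.length,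
      ∀ a b : Fin σ.length, σ.get a < σ.get b ↔
        l.get (Fin.cast e.symm a) < l.get (Fin.cast e.symm b) := by
  constructor
  · rintro ⟨f, hf, h, -⟩
    refine ⟨List.ofFn (fun i => τ.get (f i)), ?_, by simp, ?_⟩
    · rw [List.sublist_iff_exists_fin_orderEmbedding_get_eq]
      refine ⟨OrderEmbedding.ofStrictMono (fun i => f (Fin.cast (by simp) i)) ?_, ?_⟩
      · intro a b hab; exact hf (by simpa using hab)
      · intro i; simp; rfl
    · intro a b; rw [h]; simp
  · rintro ⟨l, hl, e, h⟩
    rw [List.sublist_iff_exists_fin_orderEmbedding_get_eq] at hl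
    obtain ⟨f, hf⟩ := hl
    refine ⟨fun i => f (Fin.cast e.symm i), ?_, ?_, by simp⟩
    · intro a b hab; exact f.strictMono (by simpa using hab)
    · intro a b; rw [h, hf, hf]

lemma list4 {l : List ℕ} (h : l.length = 4) : ∃ a b c d, l = [a, b, c, d] := by
  rcases l with _ | ⟨a, _ | ⟨b, _ | ⟨c, _ | ⟨d, _ | ⟨e, l⟩⟩⟩⟩⟩ <;> simp at h ⊢

lemma c132 (τ : List ℕ) : ContainsV [1, 3, 2] ∅ τ ↔ ¬ N132 τ := by
  rw [contains_iff]
  unfold N132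
  push Not
  constructor
  · rintro ⟨l, hl, e, h⟩
    obtain ⟨a, b, c, rfl⟩ := List.length_eq_three.1 e
    exact ⟨a, b, c, hl, (h 0 2).1 (by decide), (h 2 1).1 (by decide)⟩
  · rintro ⟨a, b, c, hl, hlt⟩
    refine ⟨[a, b, c], hl, rfl, fun i j => ?_⟩
    fin_cases i <;> fin_cases j <;> simp <;> omega

lemma c3214 (τ : List ℕ) : ContainsV [3, 2, 1, 4] ∅ τ ↔ ¬ N3214 τ := by
  rw [contains_iff]
  unfold N3214
  push Not
  constructor
  · rintro ⟨l, hl, e, h⟩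
    obtain ⟨a, b, c, d, rfl⟩ := list4 e
    exact ⟨a, b, c, d, hl, (h 2 1).1 (by decide), (h 1 0).1 (by decide), (h 0 3).1 (by decide)⟩
  · rintro ⟨a, b, c, d, hl, hlt⟩
    refine ⟨[a, b, c, d], hl, rfl, fun i j => ?_⟩
    fin_cases i <;> fin_cases j <;> simp <;> omega

lemma c4213 (τ : List ℕ) : ContainsV [4, 2, 1, 3] ∅ τ ↔ ¬ N4213 τ := by
  rw [contains_iff]
  unfold N4213
  push Not
  constructor
  · rintro ⟨l, hl, e, h⟩
    obtain ⟨a, b, c, d, rfl⟩ := list4 e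
    exact ⟨a, b, c, d, hl, (h 2 1).1 (by decide), (h 1 3).1 (by decide), (h 3 0).1 (by decide)⟩
  · rintro ⟨a, b, c, d, hl, hlt⟩
    refine ⟨[a, b, c, d], hl, rfl, fun i j => ?_⟩
    fin_cases i <;> fin_cases j <;> simp <;> omega

end AvCount

/-- |Av_n(132, 3214, 4213)| = 2^n - n. -/
theorem card_av_132_3214_4213 (n : ℕ) :
    {τ | IsPermList n τ ∧ ¬ ContainsV [1, 3, 2] ∅ τ ∧
      ¬ ContainsV [3, 2, 1, 4] ∅ τ ∧ ¬ ContainsV [4, 2, 1, 3] ∅ τ}.ncard = 2 ^ n - n := by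
  rw [← AvCount.card_A 1 n, ← Set.ncard_coe_finset]
  congr 1
  ext τ
  simp only [Set.mem_setOf_eq, Finset.mem_coe, AvCount.mem_S, AvCount.c132, AvCount.c3214,
    AvCount.c4213, not_not, IsPermList]
end

section
/- For every n ≥ 0, the sorting class of the 1-\underline{23}-avoiding stack-sorting map satisfies |Sort_n(sc_{1\underline{23}})| = 2^n − n. -/
theorem cont231_iff (L : List ℕ) : ContainsV [2,3,1] ∅ L ↔
    ∃ a b c, [a,b,c].Sublist L ∧ c < a ∧ a < b := by
  constructor
  · rintro ⟨f, hf, ho, -⟩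
    refine ⟨L.get (f ⟨0, by simp⟩), L.get (f ⟨1, by simp⟩), L.get (f ⟨2, by simp⟩), ?_, ?_, ?_⟩
    · rw [List.sublist_iff_exists_fin_orderEmbedding_get_eq]
      refine ⟨OrderEmbedding.ofStrictMono f hf, ?_⟩
      intro i
      fin_cases i <;> rfl
    · exact (ho ⟨2, by simp⟩ ⟨0, by simp⟩).1 (by simp)
    · exact (ho ⟨0, by simp⟩ ⟨1, by simp⟩).1 (by simp)
  · rintro ⟨a, b, c, hs, h1, h2⟩
    rw [List.sublist_iff_exists_fin_orderEmbedding_get_eq] at hs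
    obtain ⟨f, hf⟩ := hs
    refine ⟨f, f.strictMono, ?_, by simp⟩
    intro i j
    have hi := hf i
    have hj := hf j
    rw [← hi, ← hj]
    fin_cases i <;> fin_cases j <;> simp <;> omega

theorem cont123_iff (L : List ℕ) : ContainsV [1,2,3] {1} L ↔
    ∃ (i j : ℕ) (_ : i < j) (hj : j + 1 < L.length), L[i] < L[j] ∧ L[j] < L[j+1] := by
  constructor
  · rintro ⟨f, hf, ho, ha⟩
    have h3 := ha 1 rfl (by simp)
    have h01 : f ⟨0, by simp⟩ < f ⟨1, by simp⟩ := hf (by simp)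
    have h2 := (f ⟨2, by simp⟩).2
    have e0 := (ho ⟨0, by simp⟩ ⟨1, by simp⟩).1 (by simp)
    have e1 := (ho ⟨1, by simp⟩ ⟨2, by simp⟩).1 (by simp)
    have hh : (f ⟨2, by simp⟩ : ℕ) = (f ⟨1, by simp⟩ : ℕ) + 1 := h3
    refine ⟨f ⟨0, by simp⟩, f ⟨1, by simp⟩, h01, by omega, ?_, ?_⟩
    · simpa using e0
    · simp only [← hh]; simpa using e1
  · rintro ⟨i, j, hij, hj, h1, h2⟩
    refine ⟨![⟨i, by omega⟩, ⟨j, by omega⟩, ⟨j+1, hj⟩], ?_, ?_, ?_⟩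
    · intro a b hab
      fin_cases a <;> fin_cases b <;> simp at hab ⊢ <;> omega
    · intro a b
      fin_cases a <;> fin_cases b <;> simp <;> omega
    · intro a ha h
      obtain rfl : a = 1 := ha
      rfl

theorem noPat (x : ℕ) (B S : List ℕ) (hB : B.Pairwise (· > ·)) (hS : S.Pairwise (· > ·))
    (h : B = [] ∨ ∃ B' y, B = B' ++ [y] ∧ y < x) : ¬ ContainsV [1,2,3] {1} (x :: (B ++ S)) := by
  rw [cont123_iff]
  rintro ⟨i, j, hij, hj, h1, h2⟩
  obtain ⟨j, rfl⟩ : ∃ j', j = j' + 1 := ⟨j - 1, by omega⟩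
  simp only [List.getElem_cons_succ, List.length_cons, List.length_append] at h1 h2 hj
  rw [List.pairwise_iff_getElem] at hB hS
  rcases lt_trichotomy (j + 1) B.length with hl | hl | hl
  · rw [List.getElem_append_left (by omega), List.getElem_append_left (by omega)] at h2
    have := hB j (j+1) (by omega) hl (by omega)
    omega
  · rcases h with rfl | ⟨B', y, rfl, hy⟩
    · simp at hl
    · simp at hl
      subst hl
      rw [List.getElem_append_left (by simp)] at h1
      simp only [List.getElem_concat_length] at h1
      rcases i with _ | i
      · simp at h1; omega
      · simp only [List.getElem_cons_succ] at h1
        rw [List.getElem_append_left (by simp; omega)] at h1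
        have := hB i B'.length (by simp; omega) (by simp) (by omega)
        simp only [List.getElem_concat_length] at this
        omega
  · rw [List.getElem_append_right (by omega), List.getElem_append_right (by omega)] at h2
    have := hS (j - B.length) (j + 1 - B.length) (by omega) (by omega) (by omega)
    omega

theorem pat (x y s : ℕ) (B S : List ℕ) (h1 : x < y) (h2 : y < s) :
    ContainsV [1,2,3] {1} (x :: (B ++ (y :: s :: S))) := by
  rw [cont123_iff]
  refine ⟨0, B.length + 1, by omega, by simp, ?_, ?_⟩
  · simpa using h1
  · simp only [List.getElem_cons_succ]
    rw [List.getElem_append_right (by simp), List.getElem_append_right (by simp)]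
    simpa using h2

noncomputable abbrev F := scAux [1,2,3] {1}

theorem F_nil (S : List ℕ) : F S [] = S := by unfold F; simp [scAux]

theorem F_push (x : ℕ) (L inp : List ℕ) (h : ¬ ContainsV [1,2,3] {1} (x :: L)) :
    F L (x :: inp) = F (x :: L) inp := by
  unfold F
  cases L with
  | nil => simp [scAux]
  | cons y L => rw [scAux, if_neg h]

theorem F_pop (x y : ℕ) (L inp : List ℕ) (h : ContainsV [1,2,3] {1} (x :: y :: L)) :
    F (y :: L) (x :: inp) = y :: F L (x :: inp) := by
  unfold F
  rw [scAux, if_pos h]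

theorem F_sub (L inp : List ℕ) : L.Sublist (F L inp) := by
  unfold F
  fun_induction scAux [1,2,3] {1} L inp with
  | case1 => simp
  | case2 => simp
  | case3 y st x rest h ih => exact ih.cons_cons y
  | case4 y st x rest h ih => exact (List.sublist_cons_self _ _).trans ih

/-- popping a whole block -/
theorem F_popall (x y s : ℕ) (B S inp : List ℕ) (hS : (s :: S).Pairwise (· > ·)) (h1 : x < y) (h2 : y < s) :
    F (B ++ [y] ++ (s :: S)) (x :: inp) = B ++ [y] ++ F (x :: s :: S) inp := by
  induction B with
  | nil =>
    simp only [List.nil_append, List.singleton_append]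
    rw [F_pop _ _ _ _ (pat x y s [] S h1 h2), F_push]
    exact noPat x [] (s :: S) (by simp) hS (Or.inl rfl)
  | cons b B ih =>
    simp only [List.cons_append] at ih ⊢
    rw [F_pop, ih]
    have := pat x y s (b :: B) S h1 h2
    simpa using this

inductive RLs : List ℕ → Prop
  | nil : RLs []
  | cons (z : ℕ) (D rest : List ℕ) : (z :: D).Pairwise (· < ·) → (∀ w ∈ rest, w < z) → RLs rest →
      RLs (z :: D ++ rest)

theorem F_run (D rest B S : List ℕ) (y : ℕ) (hS : S.Pairwise (· > ·))
    (hB : (D.reverse ++ (B ++ [y])).Pairwise (· > ·)) :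
    F (B ++ [y] ++ S) (D ++ rest) = F (D.reverse ++ (B ++ [y]) ++ S) rest := by
  induction D generalizing B with
  | nil => simp
  | cons d D ih =>
    rw [List.cons_append, F_push]
    · have := ih (d :: B) (by simpa using hB)
      simpa using this
    · refine noPat d (B ++ [y]) S (hB.sublist (by simp)) hS (Or.inr ⟨B, y, rfl, ?_⟩)
      rw [List.pairwise_append] at hB
      exact hB.2.2 d (by simp) y (by simp)

theorem F_run0 (D rest S : List ℕ)
    (hB : (D.reverse ++ S).Pairwise (· > ·)) :
    F S (D ++ rest) = F (D.reverse ++ S) rest := by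
  induction D generalizing S with
  | nil => simp
  | cons d D ih =>
    rw [List.cons_append, F_push]
    · have := ih (d :: S) (by simpa using hB)
      simpa using this
    · exact noPat d [] S (by simp) (hB.sublist (by simp)) (Or.inl rfl)

theorem F_fwd (L : List ℕ) (hL : RLs L) (s : ℕ) (S : List ℕ) (hS : (s :: S).Pairwise (· > ·)) :
    ∀ (B : List ℕ) (y : ℕ), y < s → (B ++ [y]).Pairwise (· > ·) → (∀ w ∈ L, w < y) →
    ∃ O, F (B ++ [y] ++ (s :: S)) L = B ++ [y] ++ O ++ (s :: S) ∧ O.Pairwise (· > ·) ∧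
      O.Perm L := by
  induction hL with
  | nil => 
    intro B y _ _ _
    exact ⟨[], by simp [F_nil], by simp, by simp⟩
  | cons z D rest h1 h2 h3 ih =>
    intro B y hy hB hL
    have hz : z < y := hL z (by simp)
    have hD : (D.reverse ++ ([] ++ [z])).Pairwise (· > ·) := by
      have : (z :: D).reverse.Pairwise (· > ·) := List.pairwise_reverse.2 h1
      simpa using this
    obtain ⟨O, hO, hO1, hO2⟩ := ih (D.reverse) z (hz.trans hy) (by simpa using hD) h2
    refine ⟨D.reverse ++ [z] ++ O, ?_, ?_, ?_⟩
    · rw [List.cons_append, F_popall z y s B S _ hS hz hy]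
      have := F_run D rest [] (s :: S) z hS hD
      simp only [List.nil_append, List.singleton_append] at this
      rw [this, hO]
      simp
    · rw [List.pairwise_append]
      refine ⟨by simpa using hD, hO1, ?_⟩
      intro a ha b hb
      have := h2 b (hO2.subset hb)
      rw [List.pairwise_cons] at h1
      simp at ha
      rcases ha with ha | rfl
      · have := h1.1 a ha
        show b < a
        omega
      · exact this
    · apply List.Perm.append _ hO2
      rw [← List.reverse_cons]
      exact List.reverse_perm _

theorem F_main (inp : List ℕ) (s : ℕ) (S : List ℕ) (hS : (s :: S).Pairwise (· > ·)) :
    ∀ (B : List ℕ) (y : ℕ), y < s → (B ++ [y]).Pairwise (· > ·) →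
    (B ++ [y] ++ inp).Nodup →
    ¬ ContainsV [2,3,1] ∅ (F (B ++ [y] ++ (s :: S)) inp) →
    ∃ D rest O, inp = D ++ rest ∧ (D.reverse ++ (B ++ [y])).Pairwise (· > ·) ∧
      (∀ w ∈ rest, w < y) ∧ RLs rest ∧ 
      F (B ++ [y] ++ (s :: S)) inp = D.reverse ++ (B ++ [y]) ++ O ++ (s :: S) ∧ O.Perm rest ∧
      (rest ≠ [] → ∃ O1 v, O = O1 ++ [v] ∧ ∀ u ∈ O1, v < u) := by
  induction inp with
  | nil =>
    intro B y _ hB _ _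
    exact ⟨[], [], [], by simp, by simpa using hB, by simp, RLs.nil, by simp [F_nil], by simp, by simp⟩
  | cons x inp ih =>
    intro B y hy hB hnd hav
    have hxy : x ≠ y := by
      rintro rfl
      simp [List.nodup_append] at hnd
    rcases lt_or_gt_of_ne hxy with hlt | hgt
    · -- pop
      have hpop := F_popall x y s B S inp hS hlt hy
      rw [hpop] at hav ⊢
      obtain ⟨D, rest, O, e1, e2, e3, e4, e5, e6, e7⟩ := ih [] x (hlt.trans hy) (by simp)
        (hnd.sublist (by simp)) (by
          intro hc
          apply hav
          rw [cont231_iff] at hc ⊢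
          obtain ⟨a, b, c, h1, h2⟩ := hc
          exact ⟨a, b, c, h1.trans (by simp), h2⟩)
      simp only [List.nil_append, List.singleton_append] at e5 e2
      rw [e5] at hav ⊢
      have hxD : (x :: D).Pairwise (· < ·) := by
        have := List.pairwise_reverse.2 e2
        simpa using this
      have hlast : ∃ O1 v, D.reverse ++ [x] ++ O = O1 ++ [v] ∧ (∀ u ∈ O1, v < u) ∧ v ≤ x := by
        by_cases hr : rest = []
        · subst hr
          have : O = [] := e6.eq_nil
          subst this
          refine ⟨D.reverse, x, by simp, ?_, le_rfl⟩
          rw [List.pairwise_cons] at hxD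
          simpa using hxD.1
        · obtain ⟨O1, v, rfl, h⟩ := e7 hr
          have hv : v < x := e3 v (e6.subset (by simp))
          refine ⟨D.reverse ++ [x] ++ O1, v, by simp, ?_, hv.le⟩
          rw [List.pairwise_cons] at hxD
          intro u hu
          simp at hu
          rcases hu with hu | rfl | hu
          · exact hv.trans (hxD.1 u hu)
          · exact hv
          · exact h u hu
      have hperm : (D.reverse ++ [x] ++ O).Perm (x :: inp) := by
        rw [e1, ← List.cons_append, ← List.reverse_cons]
        exact (List.reverse_perm _).append e6
      refine ⟨[], x :: inp, D.reverse ++ [x] ++ O, by simp, by simpa using hB, ?_, ?_, by simp, hperm,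
        ?_⟩
      · obtain ⟨O1, v, h1, h2, h3⟩ := hlast
        intro w hw
        have hw' := hperm.symm.subset hw
        rw [h1] at hw'
        have hwy : w ≠ y := by
          rintro rfl
          rw [List.nodup_append] at hnd
          exact hnd.2.2 w (by simp) w hw rfl
        rcases List.mem_append.1 hw' with hw' | hw'
        · by_contra hcon
          apply hav
          rw [cont231_iff]
          refine ⟨y, w, v, ?_, by omega, by omega⟩
          have h4 : [w, v].Sublist (D.reverse ++ [x] ++ O) := by
            rw [h1]
            exact (List.singleton_sublist.2 hw').append (List.Sublist.refl [v])
          have h5 : ([y] ++ [w, v]).Sublist ((B ++ [y]) ++ ((D.reverse ++ [x] ++ O) ++ (s :: S))) :=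
            List.Sublist.append (by simp) (h4.trans (by simp))
          simpa using h5
        · simp at hw'; omega
      · rw [e1, ← List.cons_append]
        exact RLs.cons x D rest hxD e3 e4
      · intro _
        obtain ⟨O1, v, h1, h2, h3⟩ := hlast
        exact ⟨O1, v, h1, h2⟩
    · have hpush : F (B ++ [y] ++ (s :: S)) (x :: inp) = F (x :: (B ++ [y] ++ (s :: S))) inp :=
        F_push _ _ _ (noPat x (B ++ [y]) (s :: S) hB hS (Or.inr ⟨B, y, rfl, hgt⟩))
      by_cases hmid : ∀ b ∈ B ++ [y], b < x
      · have hB' : (x :: B ++ [y]).Pairwise (· > ·) := by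
          rw [List.cons_append, List.pairwise_cons]
          exact ⟨hmid, hB⟩
        rw [hpush] at hav ⊢
        obtain ⟨D, rest, O, e1, e2, e3, e4, e5, e6, e7⟩ := ih (x :: B) y hy hB'
          (by
            refine (List.Perm.nodup_iff ?_).1 hnd
            have : (B ++ [y] ++ x :: inp).Perm (x :: (B ++ [y] ++ inp)) := List.perm_middle
            simpa using this) (by simpa using hav)
        refine ⟨x :: D, rest, O, by simp [e1], by simpa using e2, e3, e4, ?_, e6, e7⟩
        simpa using e5
      · exfalso
        push Not at hmid
        obtain ⟨b, hb, hbx⟩ := hmid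
        have hne : b ≠ x := by
          rintro rfl
          rw [List.nodup_append] at hnd
          exact hnd.2.2 b hb b (by simp) rfl
        apply hav
        rw [hpush, cont231_iff]
        refine ⟨x, b, y, ?_, hgt, by omega⟩
        refine List.Sublist.trans ?_ (F_sub _ _)
        apply List.Sublist.cons_cons
        have hbB : b ∈ B := by
          rcases List.mem_append.1 hb with h | h
          · exact h
          · simp at h; omega
        have h5 : ([b] ++ [y]).Sublist (B ++ [y]) := (List.singleton_sublist.2 hbB).append (List.Sublist.refl [y])
        exact (show [b, y].Sublist (B ++ [y]) from h5).trans (by simp)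

theorem ext_lt (L1 L2 : List ℕ) (h1 : L1.Pairwise (· < ·)) (h2 : L2.Pairwise (· < ·))
    (h : ∀ x, x ∈ L1 ↔ x ∈ L2) : L1 = L2 := by
  have n1 : L1.Nodup := h1.imp (fun h => ne_of_lt h)
  have n2 : L2.Nodup := h2.imp (fun h => ne_of_lt h)
  have hp : L1.Perm L2 := (List.perm_ext_iff_of_nodup n1 n2).2 h
  exact hp.eq_of_pairwise (fun a b _ _ h h' => by omega) h1 h2

theorem range_pw (s n : ℕ) : (List.range' s n).Pairwise (· < ·) := List.pairwise_lt_range'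

theorem range_split (a b c : ℕ) (h1 : a ≤ b) (h2 : b ≤ c) :
    List.range' (a+1) (b-a) ++ List.range' (b+1) (c-b) = List.range' (a+1) (c-a) := by
  have := List.range'_append (s := a+1) (m := b-a) (n := c-b) (step := 1)
  rw [show a + 1 + 1 * (b-a) = b+1 by omega, show b - a + (c-b) = c-a by omega] at this
  exact this

theorem F_top (inp : List ℕ) : ∀ (s : ℕ) (S : List ℕ), (s :: S).Pairwise (· > ·) →
    (s :: inp).Nodup →
    ∃ C rest, inp = C ++ rest ∧ (C.reverse ++ s :: S).Pairwise (· > ·) ∧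
      (rest = [] ∨ ∃ y inp' s' S', rest = y :: inp' ∧ C.reverse ++ s :: S = s' :: S' ∧ y < s') := by
  induction inp with
  | nil => intro s S h _; exact ⟨[], [], by simp, by simpa using h, Or.inl rfl⟩
  | cons x inp ih =>
    intro s S h hnd
    have hxs : x ≠ s := by
      rintro rfl
      simp at hnd
    rcases lt_or_gt_of_ne hxs with hlt | hgt
    · exact ⟨[], x :: inp, by simp, by simpa using h, Or.inr ⟨x, inp, s, S, rfl, by simp, hlt⟩⟩
    · obtain ⟨C, rest, e1, e2, e3⟩ := ih x (s :: S) (by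
        rw [List.pairwise_cons] at h ⊢
        refine ⟨?_, by rw [List.pairwise_cons]; exact h⟩
        intro b hb
        rcases List.mem_cons.1 hb with rfl | hb
        · exact hgt
        · have := h.1 b hb
          omega) hnd.of_cons
      exact ⟨x :: C, rest, by simp [e1], by simpa using e2, by simpa using e3⟩

def RLF (m : ℕ) : Finset (List ℕ) :=
  if m = 0 then {[]} else
    (Finset.univ : Finset (Fin m)).biUnion
      (fun a => (RLF a.1).image (fun r => List.range' (a.1+1) (m-a.1) ++ r))
termination_by m
decreasing_by exact a.2

theorem RLF_zero : RLF 0 = {[]} := by rw [RLF]; simp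

theorem RLF_pos (m : ℕ) (h : m ≠ 0) : RLF m =
    (Finset.range m).biUnion
      (fun a => (RLF a).image (fun r => List.range' (a+1) (m-a) ++ r)) := by
  rw [RLF, if_neg h]
  ext L
  simp only [Finset.mem_biUnion, Finset.mem_univ, true_and, Finset.mem_range]
  constructor
  · rintro ⟨a, ha⟩; exact ⟨a.1, a.2, ha⟩
  · rintro ⟨a, h, ha⟩; exact ⟨⟨a, h⟩, ha⟩

theorem range_cons' (a m : ℕ) (h : a < m) : List.range' (a+1) (m-a) = (a+1) :: List.range' (a+2) (m-a-1) := by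
  rw [show m - a = (m-a-1)+1 by omega, List.range'_succ]
  simp

theorem two_sum (m : ℕ) : ∑ a ∈ Finset.range (m+1), 2^(a-1) = 2^m := by
  induction m with
  | zero => simp
  | succ m ih => rw [Finset.sum_range_succ, ih]; simp; ring

theorem card_RLF (m : ℕ) : (RLF m).card = 2^(m-1) := by
  induction m using Nat.strong_induction_on with
  | _ m ih =>
    rcases Nat.eq_zero_or_pos m with rfl | hm
    · simp [RLF_zero]
    · rw [RLF_pos m (by omega), Finset.card_biUnion]
      · rw [show 2^(m-1) = ∑ a ∈ Finset.range (m-1+1), 2^(a-1) from (two_sum _).symm,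
          show m - 1 + 1 = m by omega]
        apply Finset.sum_congr rfl
        intro a ha
        rw [Finset.card_image_of_injective _ (List.append_right_injective _)]
        exact ih a (Finset.mem_range.1 ha)
      · intro a ha b hb hab
        show Disjoint _ _
        rw [Finset.disjoint_left]
        intro L hL1 hL2
        rw [Finset.mem_image] at hL1 hL2
        obtain ⟨r, _, rfl⟩ := hL1
        obtain ⟨r', _, h⟩ := hL2
        simp only [Finset.coe_range, Set.mem_Iio, Finset.mem_range] at ha hb
        rw [range_cons' a m ha, range_cons' b m hb] at h
        simp at h
        omega

theorem mem_RLF (m : ℕ) : ∀ L, L ∈ RLF m ↔ RLs L ∧ L.Perm (List.range' 1 m) := by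
  induction m using Nat.strong_induction_on with
  | _ m ih =>
    intro L
    rcases Nat.eq_zero_or_pos m with rfl | hm
    · simp only [RLF_zero, Finset.mem_singleton, List.range'_zero, List.perm_nil]
      constructor
      · rintro rfl; exact ⟨RLs.nil, rfl⟩
      · exact fun h => h.2
    · rw [RLF_pos m (by omega)]
      simp only [Finset.mem_biUnion, Finset.mem_range, Finset.mem_image]
      constructor
      · rintro ⟨a, ha, r, hr, rfl⟩
        rw [ih a ha] at hr
        constructor
        · have := range_pw (a+1) (m-a)
          rw [range_cons' a m ha] at this ⊢
          refine RLs.cons _ _ _ this ?_ hr.1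
          intro w hw
          have := hr.2.subset hw
          simp [List.mem_range'_1] at this
          omega
        · have := range_split 0 a m (by omega) ha.le
          simp at this
          rw [← this]
          exact (hr.2.append_left _).trans List.perm_append_comm
      · rintro ⟨hL, hp⟩
        cases hL with
        | nil => have := hp.length_eq; simp at this; omega
        | cons z D rest h1 h2 h3 =>
          have hmem : ∀ x, x ∈ z :: D ++ rest ↔ 1 ≤ x ∧ x ≤ m := by
            intro x; rw [hp.mem_iff, List.mem_range'_1]; omega
          have hnd : (z :: D ++ rest).Nodup := hp.nodup_iff.2 (List.nodup_range')
          have hz := (hmem z).1 (by simp)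
          have hzD : ∀ x ∈ z :: D, z ≤ x := by
            intro x hx
            rcases List.mem_cons.1 hx with rfl | hx
            · exact le_rfl
            · exact (List.rel_of_pairwise_cons h1 hx).le
          refine ⟨z - 1, by omega, rest, ?_, ?_⟩
          · rw [ih _ (by omega)]
            refine ⟨h3, ?_⟩
            rw [List.perm_ext_iff_of_nodup (hnd.sublist (by simp)) List.nodup_range']
            intro w
            rw [List.mem_range'_1]
            constructor
            · intro hw
              have := h2 w hw
              have := (hmem w).1 (List.mem_append_right _ hw)
              omega
            · intro hw
              rcases List.mem_append.1 ((hmem w).2 (by omega)) with h | h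
              · have := hzD w h; omega
              · exact h
          · congr 1
            apply ext_lt _ _ (range_pw _ _) h1
            intro x
            rw [List.mem_range'_1]
            constructor
            · intro hx
              rcases List.mem_append.1 ((hmem x).2 (by omega)) with h | h
              · exact h
              · have := h2 x h; omega
            · intro hx
              have := hzD x hx
              have := (hmem x).1 (List.mem_append_left _ hx)
              omega

def shp (n m j a : ℕ) (r : List ℕ) : List ℕ :=
  List.range' (m+1) j ++ (List.range' (a+1) (m-a) ++ List.range' (m+j+1) (n-m-j) ++ r)

def Shape (n : ℕ) (L : List ℕ) : Prop :=
  L = List.range' 1 n ∨ ∃ m j a r, 1 ≤ m ∧ m < n ∧ 1 ≤ j ∧ j ≤ n - m ∧ a < m ∧ r ∈ RLF a ∧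
    L = shp n m j a r

theorem avoid_lem (P S : List ℕ) (hP : P.Pairwise (· > ·)) (hS : S.Pairwise (· > ·))
    (h : ∀ p ∈ P, ∀ b ∈ S, ∀ c ∈ S, c < p → p < b → False) :
    ¬ ContainsV [2,3,1] ∅ (P ++ S) := by
  rw [cont231_iff]
  rintro ⟨a, b, c, hs, h1, h2⟩
  rw [List.sublist_append_iff] at hs
  obtain ⟨l1, l2, e, h3, h4⟩ := hs
  match l1, e, h3 with
  | [], e, h3 =>
    simp at e; subst e
    have := hS.sublist h4
    simp at this
    omega
  | [p], e, h3 =>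
    simp at e
    obtain ⟨rfl, rfl⟩ := e
    exact h a (h3.subset (by simp)) b (h4.subset (by simp)) c (h4.subset (by simp)) h1 h2
  | p :: q :: l, e, h3 =>
    simp at e
    obtain ⟨rfl, rfl, _⟩ := e
    have := hP.sublist h3
    simp at this
    omega

theorem shape_perm (n m j a : ℕ) (r : List ℕ) (h2 : m < n)
    (h4 : j ≤ n - m) (h5 : a < m) (h6 : r.Perm (List.range' 1 a)) :
    (shp n m j a r).Perm (List.range' 1 n) := by
  have e1 := range_split 0 a n (by omega) (by omega)
  have e2 := range_split a m n (by omega) (by omega)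
  have e3 := range_split m (m+j) n (by omega) (by omega)
  simp only [Nat.zero_add, Nat.sub_zero] at e1
  rw [← e1, ← e2, ← e3]
  unfold shp
  rw [show m + j - m = j by omega, show n - (m+j) = n-m-j by omega]
  refine List.Perm.trans ?_ (h6.append_right _)
  apply Multiset.coe_eq_coe.1
  simp only [← Multiset.coe_add]
  abel

theorem shape_avoid (n m j a : ℕ) (r : List ℕ) (h2 : m < n) (h3 : 1 ≤ j)
    (h4 : j ≤ n - m) (h5 : a < m) (h6 : r ∈ RLF a) :
    ¬ ContainsV [2,3,1] ∅ (F [] (shp n m j a r)) := by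
  rw [mem_RLF] at h6
  obtain ⟨hr, hp⟩ := h6
  have hrm : ∀ w ∈ r, w < a + 1 := by
    intro w hw
    have := hp.subset hw
    rw [List.mem_range'_1] at this; omega
  unfold shp
  have hCp : (List.range' (m+1) j).reverse.Pairwise (· > ·) :=
    List.pairwise_reverse.2 (range_pw _ _)
  rw [F_run0 _ _ _ (by simpa using hCp), List.append_nil]
  have hCm : ∀ x ∈ (List.range' (m+1) j).reverse, m + 1 ≤ x ∧ x < m + 1 + j := by
    intro x hx
    rw [List.mem_reverse, List.mem_range'_1] at hx; exact hx
  have hCl : (List.range' (m+1) j).reverse.length = j := by simp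
  generalize (List.range' (m+1) j).reverse = C at *
  obtain ⟨s, S, rfl⟩ : ∃ s S, C = s :: S := by
    cases C with
    | nil => simp at hCl; omega
    | cons s S => exact ⟨s, S, rfl⟩
  set D := List.range' (a+2) (m-a-1) ++ List.range' (m+j+1) (n-m-j) with hD
  have eX : List.range' (a+1) (m-a) ++ List.range' (m+j+1) (n-m-j) = (a+1) :: D := by
    rw [range_cons' a m h5]; rfl
  have hXp : ((a+1) :: D).Pairwise (· < ·) := by
    rw [← eX, List.pairwise_append]
    refine ⟨range_pw _ _, range_pw _ _, ?_⟩
    intro x hx y hy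
    rw [List.mem_range'_1] at hx hy
    omega
  have hXm : ∀ x ∈ (a+1) :: D, a + 1 ≤ x ∧ (x ≤ m ∨ m + j + 1 ≤ x) := by
    rw [← eX]
    intro x hx
    rw [List.mem_append, List.mem_range'_1, List.mem_range'_1] at hx
    omega
  have hDr : (D.reverse ++ [a+1]).Pairwise (· > ·) := by
    have := List.pairwise_reverse.2 hXp
    simpa using this
  have hs := (hCm s (by simp)).1
  rw [eX, List.cons_append, F_push _ (s :: S) _ (noPat _ [] _ (by simp) hCp (Or.inl rfl))]
  have := F_run D r [] (s :: S) (a+1) hCp (by simpa using hDr)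
  simp only [List.nil_append, List.singleton_append] at this
  rw [this]
  obtain ⟨O, hO, hO1, hO2⟩ := F_fwd r hr s S hCp D.reverse (a+1) (by omega) hDr hrm
  rw [hO]
  have hOm : ∀ w ∈ O, w < a + 1 := fun w hw => hrm w (hO2.subset hw)
  have hXm' : ∀ x ∈ D.reverse ++ [a+1], a + 1 ≤ x ∧ (x ≤ m ∨ m + j + 1 ≤ x) := by
    intro x hx
    apply hXm
    simp only [List.mem_append, List.mem_reverse, List.mem_singleton] at hx
    rw [List.mem_cons]; tauto
  apply avoid_lem _ _ _ hCp
  · intro p hp b hb c hc hcp hpb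
    have hb' := hCm b hb
    have hc' := hCm c hc
    rcases List.mem_append.1 hp with h | h
    · have := hXm' p h; omega
    · have := hOm p h; omega
  · rw [List.pairwise_append]
    refine ⟨hDr, hO1, ?_⟩
    intro x hx y hy
    have := hXm' x hx
    have := hOm y hy
    show y < x
    omega

theorem shape_of_avoid (n : ℕ) (L : List ℕ) (hp : L.Perm (List.range' 1 n))
    (hav : ¬ ContainsV [2,3,1] ∅ (F [] L)) : Shape n L := by
  have hnd : L.Nodup := hp.nodup_iff.2 (List.nodup_range')
  have hmem : ∀ x, x ∈ L ↔ 1 ≤ x ∧ x ≤ n := by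
    intro x; rw [hp.mem_iff, List.mem_range'_1]; omega
  cases L with
  | nil =>
    left
    have := hp.length_eq
    simp at this
    simp [← this]
  | cons k inp =>
    obtain ⟨C, rest, e1, e2, e3⟩ := F_top inp k [] (by simp) hnd
    have hC : (k :: C).Pairwise (· < ·) := by
      have := List.pairwise_reverse.2 e2
      simpa using this
    rcases e3 with rfl | ⟨y, inp', s, S, rfl, e4, hys⟩
    · left
      rw [List.append_nil] at e1
      subst e1
      apply ext_lt _ _ hC (range_pw _ _)
      intro x
      rw [hmem, List.mem_range'_1]; omega
    · right
      subst e1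
      rw [e4] at e2
      have hF : F [] (k :: (C ++ y :: inp')) = F ([] ++ [y] ++ (s :: S)) inp' := by
        have := F_run0 (k :: C) (y :: inp') [] (by simpa [e4] using e2)
        rw [← List.cons_append, this, List.append_nil, List.reverse_cons, e4,
          F_push _ (s :: S) _ (noPat _ [] _ (by simp) e2 (Or.inl rfl))]
        simp
      rw [hF] at hav
      obtain ⟨D, rest, O, f1, f2, f3, f4, f5, f6, -⟩ := F_main inp' s S e2 [] y hys (by simp)
        (hnd.sublist ((List.sublist_append_right C (y :: inp')).trans (List.sublist_cons_self _ _))) hav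
      subst f1
      simp only [List.nil_append] at f2 f5 hav
      rw [f5] at hav
      have hyD : (y :: D).Pairwise (· < ·) := by
        have := List.pairwise_reverse.2 f2
        simpa using this
      have hSC : ∀ x, x ∈ s :: S ↔ x ∈ k :: C := by
        intro x; rw [← e4]; simp [or_comm]
      have hLm : ∀ x, (x ∈ k :: C ∨ x ∈ y :: D ∨ x ∈ rest) ↔ 1 ≤ x ∧ x ≤ n := by
        intro x; rw [← hmem]; simp only [List.mem_cons, List.mem_append]; tauto
      have hnd' : (k :: C ++ (y :: D ++ rest)).Nodup := by simpa using hnd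
      rw [List.nodup_append] at hnd'
      obtain ⟨-, hnd2, hdis⟩ := hnd'
      have hCk : ∀ x ∈ k :: C, k ≤ x := by
        intro x hx
        rcases List.mem_cons.1 hx with rfl | hx
        · exact le_rfl
        · exact (List.rel_of_pairwise_cons hC hx).le
      have hCs : ∀ x ∈ k :: C, x ≤ s := by
        intro x hx
        rw [← hSC] at hx
        rcases List.mem_cons.1 hx with rfl | hx
        · exact le_rfl
        · exact (List.rel_of_pairwise_cons e2 hx).le
      have hyDy : ∀ x ∈ y :: D, y ≤ x := by
        intro x hx
        rcases List.mem_cons.1 hx with rfl | hx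
        · exact le_rfl
        · exact (List.rel_of_pairwise_cons hyD hx).le
      have hkS : k ∈ s :: S := (hSC k).2 (by simp)
      have hsC : s ∈ k :: C := (hSC s).1 (by simp)
      have hks : k ≤ s := hCk s hsC
      have hsn := (hLm s).1 (Or.inl hsC)
      have hk1 := (hLm k).1 (Or.inl (by simp))
      have hy1 := (hLm y).1 (Or.inr (Or.inl (by simp)))
      have fact : ∀ x ∈ y :: D, x < k ∨ s < x := by
        intro x hx
        by_contra hcon
        push Not at hcon
        have hxk : k ≠ x := hdis k (by simp) x (List.mem_append_left _ hx)
        have hxs : s ≠ x := hdis s hsC x (List.mem_append_left _ hx)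
        apply hav
        rw [cont231_iff]
        refine ⟨x, s, k, ?_, by omega, by omega⟩
        have hk' : k ∈ S := by
          rcases List.mem_cons.1 hkS with h | h
          · omega
          · exact h
        have g1 : [x].Sublist (D.reverse ++ [y] ++ O) := by
          rw [List.singleton_sublist]
          apply List.mem_append_left
          simp only [List.mem_append, List.mem_reverse, List.mem_singleton]
          rw [List.mem_cons] at hx; tauto
        have g2 : [s, k].Sublist (s :: S) := (List.singleton_sublist.2 hk').cons_cons s
        exact g1.append g2
      have hyk : y < k := by
        rcases fact y (by simp) with h | h <;> omega
      have E1 : k :: C = List.range' k (s - k + 1) := by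
        apply ext_lt _ _ hC (range_pw _ _)
        intro x
        rw [List.mem_range'_1]
        constructor
        · intro hx
          have := hCk x hx
          have := hCs x hx
          omega
        · intro hx
          rcases (hLm x).2 (by omega) with h | h | h
          · exact h
          · have := fact x h; omega
          · have := f3 x h; omega
      have E2 : y :: D = List.range' y (k - y) ++ List.range' (s+1) (n - s) := by
        apply ext_lt _ _ hyD
        · rw [List.pairwise_append]
          refine ⟨range_pw _ _, range_pw _ _, ?_⟩
          intro a ha b hb
          rw [List.mem_range'_1] at ha hb
          omega
        intro x
        rw [List.mem_append, List.mem_range'_1, List.mem_range'_1]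
        constructor
        · intro hx
          have := hyDy x hx
          have := fact x hx
          have := (hLm x).1 (Or.inr (Or.inl hx))
          omega
        · intro hx
          rcases (hLm x).2 (by omega) with h | h | h
          · have := hCk x h
            have := hCs x h
            omega
          · exact h
          · have := f3 x h; omega
      have E3 : rest.Perm (List.range' 1 (y-1)) := by
        rw [List.perm_ext_iff_of_nodup (hnd2.sublist (by simp)) List.nodup_range']
        intro w
        rw [List.mem_range'_1]
        constructor
        · intro hw
          have := f3 w hw
          have := (hLm w).1 (Or.inr (Or.inr hw))
          omega
        · intro hw
          rcases (hLm w).2 (by omega) with h | h | h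
          · have := hCk w h; omega
          · have := hyDy w h; omega
          · exact h
      refine ⟨k-1, s-k+1, y-1, rest, by omega, by omega, by omega, by omega, by omega,
        (mem_RLF _ _).2 ⟨f4, E3⟩, ?_⟩
      unfold shp
      rw [show k - 1 + 1 = k by omega, show y - 1 + 1 = y by omega,
        show k - 1 - (y - 1) = k - y by omega, show k - 1 + (s - k + 1) + 1 = s + 1 by omega,
        show n - (k-1) - (s-k+1) = n - s by omega, ← E1, ← E2]
      simp

theorem mem_SortSet (n : ℕ) (L : List ℕ) : L ∈ SortSet [1,2,3] {1} n ↔ Shape n L := by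
  constructor
  · rintro ⟨h1, h2⟩
    exact shape_of_avoid n L h1 h2
  · rintro (rfl | ⟨m, j, a, r, h1, h2, h3, h4, h5, h6, rfl⟩)
    · refine ⟨List.Perm.refl _, ?_⟩
      have hpw : (List.range' 1 n).reverse.Pairwise (· > ·) :=
        List.pairwise_reverse.2 (range_pw _ _)
      have := F_run0 (List.range' 1 n) [] [] (by simpa using hpw)
      rw [List.append_nil, List.append_nil, F_nil] at this
      show ¬ ContainsV [2,3,1] ∅ (F [] (List.range' 1 n))
      rw [this]
      have := avoid_lem _ [] hpw (by simp) (by simp)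
      simpa using this
    · exact ⟨shape_perm n m j a r h2 h4 h5 ((mem_RLF _ _).1 h6).2,
        shape_avoid n m j a r h2 h3 h4 h5 h6⟩

def Idx (n : ℕ) : Finset (Σ _ : ℕ, Σ _ : ℕ, Σ _ : ℕ, List ℕ) :=
  (Finset.Ico 1 n).sigma fun m => (Finset.Icc 1 (n-m)).sigma fun _ => (Finset.range m).sigma fun a => RLF a

def shpI (n : ℕ) (p : Σ _ : ℕ, Σ _ : ℕ, Σ _ : ℕ, List ℕ) : List ℕ :=
  shp n p.1 p.2.1 p.2.2.1 p.2.2.2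

theorem shp_head (n m j a : ℕ) (r : List ℕ) (hj : 1 ≤ j) : (shp n m j a r)[0]? = some (m+1) := by
  obtain ⟨j, rfl⟩ : ∃ j', j = j' + 1 := ⟨j-1, by omega⟩
  simp [shp, List.range'_succ]

theorem shp_j (n m j a : ℕ) (r : List ℕ) (ha : a < m) : (shp n m j a r)[j]? = some (a+1) := by
  unfold shp
  rw [range_cons' a m ha, List.getElem?_append_right (by simp)]
  simp

theorem shp_lt (n m j a i : ℕ) (r : List ℕ) (hi : i < j) : (shp n m j a r)[i]? = some (m+1+i) := by
  unfold shp
  rw [List.getElem?_append_left (by simpa using hi)]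
  simp [hi]

theorem shpI_inj (n : ℕ) : Set.InjOn (shpI n) (Idx n : Set _) := by
  rintro ⟨m, j, a, r⟩ h ⟨m', j', a', r'⟩ h' e
  simp only [Idx, Finset.coe_sigma, Set.mem_sigma_iff, Finset.mem_coe, Finset.mem_Ico, Finset.mem_Icc,
    Finset.mem_range] at h h'
  simp only [shpI] at e
  have e0 := congrArg (fun L => L[0]?) e
  rw [shp_head _ _ _ _ _ h.2.1.1, shp_head _ _ _ _ _ h'.2.1.1] at e0
  obtain rfl : m = m' := by simpa using e0
  have hj : j = j' := by
    rcases lt_trichotomy j j' with hl | hl | hl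
    · exfalso
      have e1 := congrArg (fun L => L[j]?) e
      rw [shp_j _ _ _ _ _ h.2.2.1, shp_lt _ _ _ _ _ _ hl] at e1
      simp at e1; omega
    · exact hl
    · exfalso
      have e1 := congrArg (fun L => L[j']?) e
      rw [shp_j _ _ _ _ _ h'.2.2.1, shp_lt _ _ _ _ _ _ hl] at e1
      simp at e1; omega
  subst hj
  have e1 := congrArg (fun L => L[j]?) e
  rw [shp_j _ _ _ _ _ h.2.2.1, shp_j _ _ _ _ _ h'.2.2.1] at e1
  obtain rfl : a = a' := by simpa using e1
  unfold shp at e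
  obtain rfl : r = r' := by simpa using e
  rfl

theorem sum_eq (n : ℕ) : ∑ m ∈ Finset.Ico 1 n, (n - m) * 2^(m-1) + 1 + n = 2^n := by
  induction n with
  | zero => simp
  | succ n ih =>
    rcases Nat.eq_zero_or_pos n with rfl | hn
    · simp
    · rw [Finset.sum_Ico_succ_top (by omega)]
      have h1 : ∑ m ∈ Finset.Ico 1 n, (n + 1 - m) * 2^(m-1) =
          ∑ m ∈ Finset.Ico 1 n, (n - m) * 2^(m-1) + ∑ m ∈ Finset.Ico 1 n, 2^(m-1) := by
        rw [← Finset.sum_add_distrib]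
        apply Finset.sum_congr rfl
        intro m hm
        rw [Finset.mem_Ico] at hm
        rw [show n + 1 - m = (n - m) + 1 by omega]
        ring
      have h2 := two_sum n
      rw [Finset.sum_range_succ, Finset.range_eq_Ico, Finset.sum_eq_sum_Ico_succ_bot hn] at h2
      simp at h2
      rw [h1, pow_succ]
      simp
      omega

theorem card_Idx (n : ℕ) : (Idx n).card = ∑ m ∈ Finset.Ico 1 n, (n - m) * 2^(m-1) := by
  unfold Idx
  rw [Finset.card_sigma]
  apply Finset.sum_congr rfl
  intro m hm
  rw [Finset.mem_Ico] at hm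
  rw [Finset.card_sigma]
  have h : ∀ j ∈ Finset.Icc 1 (n-m), ((Finset.range m).sigma fun a => RLF a).card = 2^(m-1) := by
    intro j _
    rw [Finset.card_sigma]
    simp only [card_RLF]
    have := two_sum (m-1)
    rwa [show m - 1 + 1 = m by omega] at this
  rw [Finset.sum_congr rfl h]
  simp

/-- |Sort_n(sc_{1\un{23}})| = 2^n - n. -/
theorem card_sortingClass_1un23 (n : ℕ) :
    (SortSet [1, 2, 3] {1} n).ncard = 2 ^ n - n := by
  have hset : SortSet [1, 2, 3] {1} n =
      ((insert (List.range' 1 n) ((Idx n).image (shpI n)) : Finset (List ℕ)) : Set (List ℕ)) := by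
    ext L
    rw [mem_SortSet, Finset.mem_coe, Finset.mem_insert, Finset.mem_image]
    unfold Shape
    apply or_congr Iff.rfl
    constructor
    · rintro ⟨m, j, a, r, h1, h2, h3, h4, h5, h6, rfl⟩
      refine ⟨⟨m, j, a, r⟩, ?_, rfl⟩
      simp only [Idx, Finset.mem_sigma, Finset.mem_Ico, Finset.mem_Icc, Finset.mem_range]
      exact ⟨⟨h1, h2⟩, ⟨h3, h4⟩, h5, h6⟩
    · rintro ⟨⟨m, j, a, r⟩, h, rfl⟩
      simp only [Idx, Finset.mem_sigma, Finset.mem_Ico, Finset.mem_Icc, Finset.mem_range] at h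
      exact ⟨m, j, a, r, h.1.1, h.1.2, h.2.1.1, h.2.1.2, h.2.2.1, h.2.2.2, rfl⟩
  rw [hset, Set.ncard_coe_finset, Finset.card_insert_of_notMem, Finset.card_image_of_injOn (shpI_inj n),
    card_Idx]
  · have := sum_eq n
    omega
  · rw [Finset.mem_image]
    rintro ⟨⟨m, j, a, r⟩, h, e⟩
    simp only [Idx, Finset.mem_sigma, Finset.mem_Ico, Finset.mem_Icc, Finset.mem_range] at h
    have e0 := congrArg (fun L => L[0]?) e
    simp only [shpI] at e0
    rw [shp_head _ _ _ _ _ h.2.1.1] at e0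
    obtain ⟨n, rfl⟩ : ∃ n', n = n' + 1 := ⟨n-1, by omega⟩
    simp [List.range'_succ] at e0
    omega
end

section
/- For every n, the sorting class of the \underline{32}1-avoiding stack-sorting map is enumerated by the Motzkin numbers: |Sort_n(sc_{\underline{32}1})| = M_n. -/
/-- The `n`-th Motzkin number `M_n = ∑_k binom(n, 2k) · C_k`. -/
def motzkin (n : ℕ) : ℕ :=
  ∑ k ∈ Finset.range (n + 1), n.choose (2 * k) * catalan k

/-- avoidance of 231, recursively -/
def Av231 : List ℕ → Prop
  | [] => True
  | x :: l => l.Pairwise (fun y z => x < y → x ≤ z) ∧ Av231 l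

/-- head condition for the vincular pattern -/
def Hd (x : ℕ) : List ℕ → Prop
  | [] => True
  | y :: s => y < x → ∀ c ∈ s, y ≤ c

/-- avoidance of the vincular pattern, recursively -/
def AvV : List ℕ → Prop
  | [] => True
  | x :: l => Hd x l ∧ AvV l

theorem av231_iff (l : List ℕ) : Av231 l ↔
    ∀ (i j k : ℕ) (hij : i < j) (hjk : j < k) (hk : k < l.length), ¬ (l[k] < l[i] ∧ l[i] < l[j]) := by
  induction l with
  | nil => simp [Av231]
  | cons x l ih =>
    simp only [Av231, ih, List.pairwise_iff_getElem]
    constructor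
    · rintro ⟨h1, h2⟩ i j k hij hjk hk
      obtain ⟨j, rfl⟩ : ∃ j', j = j' + 1 := ⟨j - 1, by omega⟩
      obtain ⟨k, rfl⟩ : ∃ j', k = j' + 1 := ⟨k - 1, by omega⟩
      simp only [List.length_cons] at hk
      rcases i with _ | i
      · have := h1 j k (by omega) (by omega) (by omega)
        simp only [List.getElem_cons_succ, List.getElem_cons_zero]
        omega
      · have := h2 i j k (by omega) (by omega) (by omega)
        simpa only [List.getElem_cons_succ] using this
    · intro h
      constructor
      · intro j k hj hk hjk
        have := h 0 (j+1) (k+1) (by omega) (by omega) (by simp; omega)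
        simp only [List.getElem_cons_succ, List.getElem_cons_zero] at this
        omega
      · intro i j k hij hjk hk
        have := h (i+1) (j+1) (k+1) (by omega) (by omega) (by simp; omega)
        simpa only [List.getElem_cons_succ] using this

theorem avV_iff (l : List ℕ) : AvV l ↔
    ∀ (i k : ℕ) (hik : i + 1 < k) (hk : k < l.length), ¬ (l[k] < l[i+1] ∧ l[i+1] < l[i]) := by
  induction l with
  | nil => simp [AvV]
  | cons x l ih =>
    simp only [AvV, ih]
    constructor
    · rintro ⟨h1, h2⟩ i k hik hk
      obtain ⟨k, rfl⟩ : ∃ j', k = j' + 1 := ⟨k - 1, by omega⟩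
      simp only [List.length_cons] at hk
      rcases i with _ | i
      · rcases l with _ | ⟨y, s⟩
        · simp at hk
        · obtain ⟨k, rfl⟩ : ∃ j', k = j' + 1 := ⟨k - 1, by omega⟩
          simp only [List.length_cons] at hk
          simp only [Hd] at h1
          have h3 : s[k] ∈ s := List.getElem_mem _
          simp only [List.getElem_cons_succ, List.getElem_cons_zero]
          rintro ⟨h4, h5⟩
          have := h1 h5 _ h3
          omega
      · have := h2 i k (by omega) (by omega)
        simpa only [List.getElem_cons_succ] using this
    · intro h
      constructor
      · rcases l with _ | ⟨y, s⟩
        · simp [Hd]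
        · simp only [Hd]
          intro hy c hc
          obtain ⟨k, hk, rfl⟩ := List.getElem_of_mem hc
          have := h 0 (k+2) (by omega) (by simp; omega)
          simp only [List.getElem_cons_succ, List.getElem_cons_zero] at this
          omega
      · intro i k hik hk
        have := h (i+1) (k+1) (by omega) (by simp; omega)
        simpa only [List.getElem_cons_succ] using this

theorem containsV_231 (l : List ℕ) : ContainsV [2,3,1] ∅ l ↔ ¬ Av231 l := by
  rw [av231_iff]
  push Not
  constructor
  · rintro ⟨f, hf, h, -⟩
    refine ⟨f 0, f 1, f 2, hf (by decide), hf (by decide), (f 2).2, ?_, ?_⟩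
    · have := (h 2 0).1 (by decide)
      simpa using this
    · have := (h 0 1).1 (by decide)
      simpa using this
  · rintro ⟨i, j, k, hij, hjk, hk, h1, h2⟩
    refine ⟨![⟨i, by omega⟩, ⟨j, by omega⟩, ⟨k, hk⟩], ?_, ?_, by simp⟩
    · intro a b hab
      fin_cases a <;> fin_cases b <;> simp at hab ⊢ <;> omega
    · intro a b
      fin_cases a <;> fin_cases b <;> simp <;> omega

theorem containsV_321 (l : List ℕ) : ContainsV [3,2,1] {0} l ↔ ¬ AvV l := by
  rw [avV_iff]
  push Not
  constructor
  · rintro ⟨f, hf, h, hA⟩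
    have h0 : (f 1 : ℕ) = f 0 + 1 := hA 0 rfl (by simp)
    have h12 : f 1 < f 2 := hf (by decide)
    refine ⟨f 0, f 2, by omega, (f 2).2, ?_, ?_⟩
    · have := (h 2 1).1 (by decide)
      simpa [h0] using this
    · have := (h 1 0).1 (by decide)
      simpa [h0] using this
  · rintro ⟨i, k, hik, hk, h1, h2⟩
    refine ⟨![⟨i, by omega⟩, ⟨i+1, by omega⟩, ⟨k, hk⟩], ?_, ?_, ?_⟩
    · intro a b hab
      fin_cases a <;> fin_cases b <;> simp at hab ⊢ <;> omega
    · intro a b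
      fin_cases a <;> fin_cases b <;> simp <;> omega
    · rintro a rfl h
      simp

theorem sublist_scAux (s l : List ℕ) : s.Sublist (scAux [3,2,1] {0} s l) := by
  induction s, l using scAux.induct with
  | σ => exact [3,2,1]
  | A => exact {0}
  | case1 s => simp [scAux]
  | case2 => simp
  | case3 y s x r h ih => 
    rw [scAux, if_pos h]
    exact ih.cons_cons _
  | case4 y s x r h ih => 
    rw [scAux, if_neg h]
    exact (List.sublist_cons_self _ _).trans ih

theorem pop_lemma (c x : ℕ) (r : List ℕ) (hcx : c < x) (s : List ℕ) (hs : AvV s) (hc : c ∈ s)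
    (hm : ∀ d ∈ s, c ≤ d) : [x, c].Sublist (scAux [3,2,1] {0} s (x :: r)) := by
  induction s with
  | nil => simp at hc
  | cons y s ih =>
    rw [scAux]
    split_ifs with h
    · rw [containsV_321] at h
      simp only [AvV, Hd] at h hs
      simp only [List.mem_cons] at hc hm
      have hyc : c ≠ y := by
        rintro rfl
        apply h
        exact ⟨fun _ d hd => hm d (Or.inr hd), hs⟩
      have := ih hs.2 (by tauto) (fun d hd => hm d (Or.inr hd))
      exact this.trans (List.sublist_cons_self _ _)
    · refine List.Sublist.trans ?_ (sublist_scAux _ _)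
      apply List.Sublist.cons_cons
      simpa using hc

theorem not_av231 (l : List ℕ) (a b c : ℕ) (h : [a,b,c].Sublist l) (h1 : c < a) (h2 : a < b) :
    ¬ Av231 l := by
  induction l with
  | nil => simp at h
  | cons x l ih =>
    rintro ⟨h3, h4⟩
    cases h with
    | cons _ h => exact ih h h4
    | cons_cons _ h =>
      have := h3.sublist h
      simp at this
      omega

theorem exists_min (s : List ℕ) (c : ℕ) (hc : c ∈ s) : ∃ m ∈ s, m ≤ c ∧ ∀ d ∈ s, m ≤ d := by
  obtain ⟨m, hm, h⟩ := Finset.exists_min_image s.toFinset id ⟨c, by simpa using hc⟩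
  simp only [List.mem_toFinset, id] at hm h
  exact ⟨m, hm, h c hc, h⟩

theorem scAux_main (l : List ℕ) : ∀ s : List ℕ, AvV s → Av231 (scAux [3,2,1] {0} s l) →
    AvV (l.reverse ++ s) := by
  induction l with
  | nil => intro s hs _; simpa using hs
  | cons x r ih =>
    intro s hs h
    rcases s with _ | ⟨y, s⟩
    · rw [scAux] at h
      have := ih [x] (by simp [AvV, Hd]) h
      simpa using this
    · rw [scAux] at h
      split_ifs at h with hV
      · exfalso
        rw [containsV_321] at hV
        have h5 : y < x ∧ ∃ c ∈ s, c < y := by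
          by_contra hcon
          push Not at hcon
          exact hV ⟨fun hy c hc => hcon hy c hc, hs⟩
        obtain ⟨hyx, c, hc, hcy⟩ := h5
        obtain ⟨m, hm, hmc, hmin⟩ := exists_min s c hc
        have := pop_lemma m x r (by omega) s hs.2 hm hmin
        exact not_av231 _ y x m (this.cons_cons _) (by omega) hyx h
      · rw [containsV_321, not_not] at hV
        have := ih _ hV h
        simpa using this

theorem avV_suffix (p l : List ℕ) (h : AvV (p ++ l)) : AvV l := by
  induction p with
  | nil => simpa using h
  | cons x p ih => exact ih h.2

theorem scAux_rev (l : List ℕ) : ∀ s : List ℕ, AvV (l.reverse ++ s) →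
    scAux [3,2,1] {0} s l = l.reverse ++ s := by
  induction l with
  | nil => intro s _; simp [scAux]
  | cons x r ih =>
    intro s h
    have h' : AvV (r.reverse ++ (x :: s)) := by simpa using h
    have := ih _ h'
    have h2 := avV_suffix _ _ h'
    rcases s with _ | ⟨y, s⟩
    · rw [scAux, this]; simp
    · rw [scAux, if_neg, this]
      · simp
      · rw [containsV_321, not_not]; exact h2

theorem sort_iff (l : List ℕ) : ¬ ContainsV [2,3,1] ∅ (sc [3,2,1] {0} l) ↔
    AvV l.reverse ∧ Av231 l.reverse := by
  rw [containsV_231, not_not, sc]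
  constructor
  · intro h
    have h1 := scAux_main l [] trivial h
    have h2 := scAux_rev l [] h1
    rw [h2] at h
    simpa using And.intro h1 h
  · rintro ⟨h1, h2⟩
    rw [scAux_rev l [] (by simpa using h1)]
    simpa using h2

/-! ### Structure -/

theorem av231_suffix (p l : List ℕ) (h : Av231 (p ++ l)) : Av231 l := by
  induction p with
  | nil => simpa using h
  | cons x p ih => exact ih h.2

theorem av231_prefix (p l : List ℕ) (h : Av231 (p ++ l)) : Av231 p := by
  induction p with
  | nil => trivial
  | cons x p ih => exact ⟨(List.pairwise_append.1 h.1).1, ih h.2⟩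

theorem avV_prefix (p l : List ℕ) (h : AvV (p ++ l)) : AvV p := by
  induction p with
  | nil => trivial
  | cons x p ih =>
    refine ⟨?_, ih h.2⟩
    rcases p with _ | ⟨y, p⟩
    · trivial
    · intro hy c hc
      exact h.1 hy c (by simp [hc])

theorem av231_build (B A : List ℕ) (m : ℕ) (hB : ∀ b ∈ B, b < m) (hA : ∀ a ∈ A, a < m)
    (hBA : ∀ b ∈ B, ∀ a ∈ A, b < a) (h1 : Av231 B) (h2 : Av231 A) : Av231 (B ++ m :: A) := by
  induction B with
  | nil =>
    refine ⟨?_, h2⟩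
    rw [List.pairwise_iff_forall_sublist]
    intro a b hab hm
    have := hA a (hab.subset (by simp))
    omega
  | cons x B ih =>
    simp only [List.mem_cons, forall_eq_or_imp] at hB hBA
    refine ⟨?_, ih hB.2 hBA.2 h1.2⟩
    have key : ∀ z ∈ m :: A, x ≤ z := by
      simp only [List.mem_cons, forall_eq_or_imp]
      exact ⟨hB.1.le, fun a ha => (hBA.1 a ha).le⟩
    refine List.pairwise_append.2 ⟨h1.1, ?_, fun a _ z hz _ => key z hz⟩
    rw [List.pairwise_iff_forall_sublist]
    intro a b hab _
    exact key b (hab.subset (by simp))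

theorem avV_build (B A : List ℕ) (m : ℕ) (hB : ∀ b ∈ B, b < m)
    (hBA : ∀ b ∈ B, ∀ a ∈ A, b < a) (h1 : AvV B) (h2 : AvV (m :: A)) : AvV (B ++ m :: A) := by
  induction B with
  | nil => exact h2
  | cons x B ih =>
    simp only [List.mem_cons, forall_eq_or_imp] at hB hBA
    refine ⟨?_, ih hB.2 hBA.2 h1.2⟩
    rcases B with _ | ⟨y, B⟩
    · intro hm; omega
    · intro hy c hc
      replace hc : c ∈ B ++ m :: A := hc
      simp only [List.mem_append, List.mem_cons, forall_eq_or_imp] at hc hB hBA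
      rcases hc with hc | rfl | hc
      · exact h1.1 hy c hc
      · exact hB.2.1.le
      · exact (hBA.2.1 c hc).le

theorem av231_lt (B A : List ℕ) (m : ℕ) (hB : ∀ b ∈ B, b < m) (h : Av231 (B ++ m :: A)) :
    ∀ b ∈ B, ∀ a ∈ A, b ≤ a := by
  intro b hb a ha
  by_contra hcon
  refine not_av231 _ b m a ?_ (by omega) (hB b hb) h
  have : ([b] ++ [m,a]).Sublist (B ++ m :: A) :=
    List.Sublist.append (by simpa using hb) (List.Sublist.cons_cons _ (by simpa using ha))
  simpa using this

theorem split_perm (B A : List ℕ) (off n : ℕ) (h : (B ++ A).Perm (List.range' off n))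
    (hBA : ∀ b ∈ B, ∀ a ∈ A, b ≤ a) :
    B.Perm (List.range' off B.length) ∧ A.Perm (List.range' (off + B.length) (n - B.length)) := by
  have hs : ∀ l : List ℕ, (l.insertionSort (· ≤ ·)).Perm l := fun l => List.perm_insertionSort _ l
  have e : B.insertionSort (· ≤ ·) ++ A.insertionSort (· ≤ ·) = List.range' off n := by
    apply List.Perm.eq_of_pairwise (le := (· ≤ ·))
    · intro a b _ _ h1 h2; exact le_antisymm h1 h2
    · rw [List.pairwise_append]
      refine ⟨List.pairwise_insertionSort _ _, List.pairwise_insertionSort _ _, ?_⟩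
      intro b hb a ha
      exact hBA b ((hs B).mem_iff.1 hb) a ((hs A).mem_iff.1 ha)
    · exact (List.pairwise_lt_range' (s := off) (n := n)).imp (fun h => le_of_lt h)
    · exact ((hs B).append (hs A)).trans h
  have hl : B.length ≤ n := by
    have := h.length_eq
    simp at this; omega
  have e2 : List.range' off n = List.range' off B.length ++
      List.range' (off + B.length) (n - B.length) := by
    rw [List.range'_append_1]; congr 1; omega
  rw [e2] at e
  obtain ⟨h1, h2⟩ := List.append_inj e (by simp [(hs B).length_eq])
  exact ⟨h1 ▸ (hs B).symm, h2 ▸ (hs A).symm⟩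

/-- recursive description of the class -/
def G : ℕ → ℕ → Finset (List ℕ)
  | 0, _ => {[]}
  | n + 1, off =>
    (G n off).image (fun B => B ++ [off + n]) ∪
    (Finset.univ : Finset (Fin n)).biUnion (fun k =>
      (G k.1 off ×ˢ G (n - 1 - k.1) (off + k.1 + 1)).image
        (fun p => p.1 ++ (off + n) :: (off + k.1) :: p.2))
termination_by n => n
decreasing_by all_goals omega

theorem mem_range'_off {off n x : ℕ} : x ∈ List.range' off n ↔ off ≤ x ∧ x < off + n := by
  simp [List.mem_range'_1]

theorem mem_G (n : ℕ) : ∀ (off : ℕ) (l : List ℕ),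
    l ∈ G n off ↔ l.Perm (List.range' off n) ∧ AvV l ∧ Av231 l := by
  induction n using Nat.strong_induction_on with
  | _ n ih =>
  rcases n with _ | n
  · intro off l
    rw [G]
    simp only [Finset.mem_singleton, List.range'_zero, List.perm_nil]
    constructor
    · rintro rfl; exact ⟨rfl, trivial, trivial⟩
    · exact fun h => h.1
  intro off l
  rw [G]
  simp only [Finset.mem_union, Finset.mem_image, Finset.mem_biUnion, Finset.mem_univ, true_and,
    Finset.mem_product, Prod.exists]
  constructor
  · rintro (⟨B, hB, rfl⟩ | ⟨⟨k, hk⟩, B, A, ⟨hB, hA⟩, rfl⟩)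
    · obtain ⟨hp, h1, h2⟩ := (ih n (by omega) _ _).1 hB
      have hlt : ∀ b ∈ B, b < off + n := fun b hb => (mem_range'_off.1 (hp.mem_iff.1 hb)).2
      refine ⟨?_, avV_build B [] _ hlt (by simp) h1 ?_, av231_build B [] _ hlt (by simp) (by simp) h2 trivial⟩
      · rw [List.range'_1_concat]
        exact hp.append_right _
      · exact ⟨trivial, trivial⟩
    · simp only at hB hA ⊢
      obtain ⟨hp, h1, h2⟩ := (ih k (by omega) _ _).1 hB
      obtain ⟨hp', h1', h2'⟩ := (ih (n - 1 - k) (by omega) _ _).1 hA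
      have hB' : ∀ b ∈ B, b < off + k := fun b hb => (mem_range'_off.1 (hp.mem_iff.1 hb)).2
      have hA' : ∀ a ∈ A, off + k < a ∧ a < off + n := fun a ha => by
        have := (mem_range'_off.1 (hp'.mem_iff.1 ha)); omega
      have hlt : ∀ b ∈ B, b < off + n := fun b hb => by have := hB' b hb; omega
      have hBA : ∀ b ∈ B, ∀ a ∈ (off + k) :: A, b < a := by
        intro b hb a ha
        have := hB' b hb
        rcases List.mem_cons.1 ha with rfl | ha
        · exact this
        · have := hA' a ha; omega
      refine ⟨?_, avV_build B _ _ hlt hBA h1 ?_, av231_build B _ _ hlt ?_ hBA h2 ?_⟩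
      · rw [List.range'_1_concat]
        have e2 : List.range' off n = List.range' off k ++
            (off + k) :: List.range' (off + k + 1) (n - 1 - k) := by
          rw [← List.range'_succ, List.range'_append_1]; congr 1; omega
        rw [e2]
        have : (B ++ (off + k) :: A).Perm (List.range' off k ++
            (off + k) :: List.range' (off + k + 1) (n - 1 - k)) := hp.append (hp'.cons _)
        exact List.perm_middle.trans ((this.cons _).trans (List.perm_append_singleton _ _).symm)
      · refine ⟨fun _ c hc => (hA' c hc).1.le, ?_, h1'⟩
        rcases A with _ | ⟨y, A⟩
        · trivial
        · intro hy
          have := hA' y (by simp); omega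
      · intro a ha
        rcases List.mem_cons.1 ha with rfl | ha
        · omega
        · exact (hA' a ha).2
      · refine ⟨?_, h2'⟩
        rw [List.pairwise_iff_forall_sublist]
        intro a b hab _
        exact (hA' b (hab.subset (by simp))).1.le
  · rintro ⟨hp, h1, h2⟩
    have hm : off + n ∈ l := hp.mem_iff.2 (mem_range'_off.2 (by omega))
    obtain ⟨B, A, rfl⟩ := List.append_of_mem hm
    have hq : (B ++ A).Perm (List.range' off n) := by
      rw [List.range'_1_concat] at hp
      have := List.perm_middle.symm.trans (hp.trans (List.perm_append_singleton _ _))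
      exact this.cons_inv
    have hB : ∀ b ∈ B, b < off + n := fun b hb =>
      (mem_range'_off.1 (hq.mem_iff.1 (List.mem_append_left _ hb))).2
    have hA : ∀ b ∈ A, b < off + n := fun b hb =>
      (mem_range'_off.1 (hq.mem_iff.1 (List.mem_append_right _ hb))).2
    have hBA := av231_lt B A _ hB h2
    obtain ⟨hpB, hpA⟩ := split_perm B A off n hq hBA
    have hlen := hq.length_eq
    simp only [List.length_append, List.length_range'] at hlen
    rcases A with _ | ⟨a, A⟩
    · left
      refine ⟨B, (ih n (by omega) _ _).2 ⟨by simpa using hq, avV_prefix _ _ h1, av231_prefix _ _ h2⟩, rfl⟩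
    · right
      simp only [List.length_cons] at hlen
      have e : List.range' (off + B.length) (n - B.length) =
          (off + B.length) :: List.range' (off + B.length + 1) (n - 1 - B.length) := by
        rw [← List.range'_succ]; congr 1; omega
      rw [e] at hpA
      have hV := avV_suffix _ _ h1
      have hmin : ∀ c ∈ A, a ≤ c := fun c hc => hV.1 (hA a (by simp)) c hc
      have ha : a = off + B.length := by
        have h3 : off + B.length ∈ a :: A := hpA.mem_iff.2 (by simp)
        have h4 : a ∈ (off + B.length) :: List.range' (off + B.length + 1) (n - 1 - B.length) :=
          hpA.mem_iff.1 (by simp)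
        rw [List.mem_cons, mem_range'_off] at h4
        rcases List.mem_cons.1 h3 with h3 | h3
        · exact h3.symm
        · have := hmin _ h3; omega
      subst ha
      refine ⟨⟨B.length, by omega⟩, B, A, ⟨?_, ?_⟩, rfl⟩
      · exact (ih _ (by omega) _ _).2 ⟨hpB, avV_prefix _ _ h1, av231_prefix _ _ h2⟩
      · exact (ih _ (by simp only; omega) _ _).2 ⟨hpA.cons_inv, hV.2.2, (av231_suffix _ _ h2).2.2⟩

theorem length_G {n off : ℕ} {l : List ℕ} (h : l ∈ G n off) : l.length = n := by
  have := ((mem_G n off l).1 h).1.length_eq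
  simpa using this

theorem idx_G {k off n : ℕ} {l r : List ℕ} (h : l ∈ G k off) (hk : k ≤ n) :
    (l ++ (off + n) :: r).idxOf (off + n) = k := by
  have hn : off + n ∉ l := by
    intro hc
    have := mem_range'_off.1 (((mem_G k off l).1 h).1.mem_iff.1 hc)
    omega
  rw [List.idxOf_append_of_notMem hn, length_G h]
  simp

theorem card_G_succ (n off : ℕ) : (G (n+1) off).card = (G n off).card +
    ∑ k : Fin n, (G k.1 off).card * (G (n - 1 - k.1) (off + k.1 + 1)).card := by
  rw [G, Finset.card_union_of_disjoint, Finset.card_biUnion, Finset.card_image_of_injective]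
  · congr 1
    apply Finset.sum_congr rfl
    intro k _
    rw [Finset.card_image_of_injOn, Finset.card_product]
    rintro ⟨B, A⟩ h ⟨B', A'⟩ h' heq
    simp only [Finset.coe_product, Set.mem_prod, Finset.mem_coe] at h h' heq
    obtain ⟨h1, h2⟩ := List.append_inj heq (by rw [length_G h.1, length_G h'.1])
    simp only [List.cons.injEq, true_and] at h2
    simp [h1, h2]
  · intro B B' h
    simpa using h
  · intro k _ k' _ hkk
    rw [Function.onFun, Finset.disjoint_left]
    intro l hl hl'
    simp only [Finset.mem_image, Finset.mem_product, Prod.exists] at hl hl'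
    obtain ⟨B, A, ⟨hB, hA⟩, rfl⟩ := hl
    obtain ⟨B', A', ⟨hB', hA'⟩, he⟩ := hl'
    have h1 := idx_G (r := (off + k.1) :: A) hB k.2.le
    have h2 := idx_G (r := (off + k'.1) :: A') hB' k'.2.le
    rw [he, h1] at h2
    exact hkk (Fin.ext h2)
  · rw [Finset.disjoint_left]
    intro l hl hl'
    simp only [Finset.mem_image, Finset.mem_product, Prod.exists, Finset.mem_biUnion,
      Finset.mem_univ, true_and] at hl hl'
    obtain ⟨B, hB, rfl⟩ := hl
    obtain ⟨k', B', A', ⟨hB', hA'⟩, he⟩ := hl'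
    have h1 := idx_G (r := []) hB le_rfl
    have h2 := idx_G (r := (off + k'.1) :: A') hB' k'.2.le
    rw [he, h1] at h2
    have := k'.2
    omega

/-! ### Motzkin recurrence -/

theorem choose_conv (a b m : ℕ) :
    ∑ p ∈ Finset.HasAntidiagonal.antidiagonal m, p.1.choose a * p.2.choose b = (m + 1).choose (a + b + 1) := by
  induction m generalizing b with
  | zero =>
    rcases a with _ | a <;> rcases b with _ | b <;> simp
    all_goals exact (Nat.choose_eq_zero_of_lt (by omega)).symm
  | succ m ih =>
    rw [Finset.Nat.antidiagonal_succ', Finset.sum_cons, Finset.sum_map]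
    rcases b with _ | b
    · have := ih 0
      simp only [Nat.choose_zero_right, mul_one] at this
      simp [this, Nat.choose_succ_succ (m+1) a]
    · have h1 := ih b
      have h2 := ih (b+1)
      simp only [Function.Embedding.prodMap, Function.Embedding.coeFn_mk, Prod.map,
        Function.Embedding.refl_apply, Nat.succ_eq_add_one, Nat.choose_succ_succ _ b, mul_add,
        Finset.sum_add_distrib, h1, h2]
      rw [show a + (b + 1) + 1 = (a + b + 1) + 1 by ring, Nat.choose_succ_succ (m+1) (a+b+1)]
      simp

theorem motzkin_eq (n N : ℕ) (h : n < N) :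
    motzkin n = ∑ k ∈ Finset.range N, n.choose (2 * k) * catalan k := by
  unfold motzkin
  apply Finset.sum_subset
  · intro x; simp only [Finset.mem_range]; omega
  · intro k _ hk
    simp only [Finset.mem_range] at hk
    rw [Nat.choose_eq_zero_of_lt (by omega), zero_mul]

theorem tri_sum (N : ℕ) (f : ℕ → ℕ → ℕ) (hf : ∀ a b, N ≤ a + b → f a b = 0) :
    ∑ a ∈ Finset.range N, ∑ b ∈ Finset.range N, f a b =
      ∑ k ∈ Finset.range N, ∑ p ∈ Finset.HasAntidiagonal.antidiagonal k, f p.1 p.2 := by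
  rw [← Finset.sum_product', Finset.sum_sigma']
  symm
  apply Finset.sum_of_injOn (fun q => q.2)
  · rintro ⟨k, p⟩ h ⟨k', p'⟩ h' heq
    simp only [Finset.coe_sigma, Set.mem_sigma_iff, Finset.mem_coe, Finset.HasAntidiagonal.mem_antidiagonal] at h h' heq
    subst heq
    obtain rfl : k = k' := by omega
    rfl
  · rintro ⟨k, p⟩ h
    simp only [Finset.coe_sigma, Set.mem_sigma_iff, Finset.mem_coe, Finset.HasAntidiagonal.mem_antidiagonal,
      Finset.mem_range, Finset.mem_product] at h ⊢
    omega
  · rintro ⟨a, b⟩ _ h2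
    apply hf
    by_contra hcon
    apply h2
    refine ⟨⟨a + b, (a, b)⟩, ?_, rfl⟩
    simp; omega
  · intros; rfl

theorem motzkin_conv (m : ℕ) :
    ∑ p ∈ Finset.HasAntidiagonal.antidiagonal m, motzkin p.1 * motzkin p.2 =
      ∑ k ∈ Finset.range (m + 1), (m + 1).choose (2 * k + 1) * catalan (k + 1) := by
  have h1 : ∑ p ∈ Finset.HasAntidiagonal.antidiagonal m, motzkin p.1 * motzkin p.2 =
      ∑ p ∈ Finset.HasAntidiagonal.antidiagonal m, ∑ a ∈ Finset.range (m+1), ∑ b ∈ Finset.range (m+1),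
        (p.1.choose (2*a) * p.2.choose (2*b)) * (catalan a * catalan b) := by
    apply Finset.sum_congr rfl
    intro p hp
    rw [Finset.HasAntidiagonal.mem_antidiagonal] at hp
    rw [motzkin_eq p.1 (m+1) (by omega), motzkin_eq p.2 (m+1) (by omega), Finset.sum_mul_sum]
    refine Finset.sum_congr rfl fun a _ => Finset.sum_congr rfl fun b _ => by ring
  rw [h1, Finset.sum_comm]
  have h2 : ∀ a ∈ Finset.range (m+1), ∑ p ∈ Finset.HasAntidiagonal.antidiagonal m, ∑ b ∈ Finset.range (m+1),
        (p.1.choose (2*a) * p.2.choose (2*b)) * (catalan a * catalan b) =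
      ∑ b ∈ Finset.range (m+1), (m+1).choose (2*a+2*b+1) * (catalan a * catalan b) := by
    intro a _
    rw [Finset.sum_comm]
    refine Finset.sum_congr rfl fun b _ => ?_
    rw [← Finset.sum_mul, choose_conv]
  rw [Finset.sum_congr rfl h2, tri_sum]
  · refine Finset.sum_congr rfl fun k _ => ?_
    rw [catalan_succ', Finset.mul_sum]
    refine Finset.sum_congr rfl fun p hp => ?_
    rw [Finset.HasAntidiagonal.mem_antidiagonal] at hp
    rw [← hp]; ring_nf
  · intro a b hab
    rw [Nat.choose_eq_zero_of_lt (by omega), zero_mul]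

theorem motzkin_succ_succ (m : ℕ) : motzkin (m + 2) = motzkin (m + 1) +
    ∑ p ∈ Finset.HasAntidiagonal.antidiagonal m, motzkin p.1 * motzkin p.2 := by
  rw [motzkin_conv, motzkin_eq (m+2) (m+3) (by omega), motzkin_eq (m+1) (m+3) (by omega),
    Finset.sum_range_succ', Finset.sum_range_succ' _ (m+2)]
  have : ∑ k ∈ Finset.range (m + 1), (m + 1).choose (2 * k + 1) * catalan (k + 1) =
      ∑ k ∈ Finset.range (m + 2), (m + 1).choose (2 * k + 1) * catalan (k + 1) := by
    rw [Finset.sum_range_succ _ (m+1), Nat.choose_eq_zero_of_lt (show m + 1 < 2 * (m+1) + 1 by omega)]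
    simp
  rw [this]
  have h : ∀ k, (m+2).choose (2 * (k+1)) * catalan (k+1) =
      (m+1).choose (2*(k+1)) * catalan (k+1) + (m+1).choose (2*k+1) * catalan (k+1) := by
    intro k
    rw [show 2 * (k+1) = (2*k+1)+1 by ring, Nat.choose_succ_succ (m+1)]
    ring
  simp only [h, Finset.sum_add_distrib]
  simp
  ring

theorem card_G (n : ℕ) : ∀ off, (G n off).card = motzkin n := by
  induction n using Nat.strong_induction_on with
  | _ n ih =>
  intro off
  rcases n with _ | n
  · rw [G]; simp [motzkin]
  rw [card_G_succ, ih n (by omega)]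
  rcases n with _ | m
  · simp [motzkin, Finset.sum_range_succ]
  rw [motzkin_succ_succ, Finset.Nat.sum_antidiagonal_eq_sum_range_succ_mk, ← Fin.sum_univ_eq_sum_range (fun k => motzkin k * motzkin (m - k))]
  congr 1
  refine Finset.sum_congr rfl fun k _ => ?_
  rw [ih k.1 (by omega), ih _ (by omega)]
  congr 2

/-- |Sort_n(sc_{\un{32}1})| = M_n, the n-th Motzkin number. -/
theorem card_sortingClass_un321 (n : ℕ) :
    (SortSet [3, 2, 1] {0} n).ncard = motzkin n := by
  have h : SortSet [3, 2, 1] {0} n = List.reverse '' (G n 1 : Set (List ℕ)) := by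
    ext l
    simp only [SortSet, IsPermList, Set.mem_setOf_eq, sort_iff, Set.mem_image, Finset.mem_coe, mem_G]
    constructor
    · rintro ⟨h1, h2⟩
      exact ⟨l.reverse, ⟨(List.reverse_perm l).trans h1, h2⟩, by simp⟩
    · rintro ⟨r, ⟨h1, h2⟩, rfl⟩
      exact ⟨(List.reverse_perm r).trans h1, by simpa using h2⟩
  rw [h, Set.ncard_image_of_injective _ List.reverse_injective, Set.ncard_coe_finset, card_G]
end

section
/- For every n ≥ 1, the sorting class of the 3\underline{21}-avoiding stack-sorting map satisfies |Sort_n(sc_{3\underline{21}})| = 2^{n−1}. -/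
def Dsc (x : ℕ) : List ℕ → Prop
  | [] => False
  | [_] => False
  | b :: c :: l => (c < b ∧ b < x) ∨ Dsc x (c :: l)

def CV : List ℕ → Prop
  | [] => False
  | x :: l => Dsc x l ∨ CV l

def Inv231 (x : ℕ) : List ℕ → Prop
  | [] => False
  | b :: l => (x < b ∧ ∃ c ∈ l, c < x) ∨ Inv231 x l

def C231 : List ℕ → Prop
  | [] => False
  | x :: l => Inv231 x l ∨ C231 l

theorem Dsc_iff (x : ℕ) (l : List ℕ) :
    Dsc x l ↔ ∃ j, ∃ h : j + 1 < l.length, l[j+1] < l[j] ∧ l[j] < x := by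
  induction l with
  | nil => simp [Dsc]
  | cons b l ih =>
    cases l with
    | nil => simp [Dsc]
    | cons c l =>
      rw [Dsc, ih]
      constructor
      · rintro (h | ⟨j, h, h'⟩)
        · exact ⟨0, by simp, by simpa using h⟩
        · exact ⟨j + 1, by simpa using h, by simpa using h'⟩
      · rintro ⟨j, h, h'⟩
        cases j with
        | zero => left; simpa using h'
        | succ j => right; exact ⟨j, by simpa using h, by simpa using h'⟩

theorem CV_iff (l : List ℕ) :
    CV l ↔ ∃ i j, ∃ h : j + 1 < l.length, ∃ h' : i < j, l[j+1] < l[j] ∧ l[j] < l[i] := by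
  induction l with
  | nil => simp [CV]
  | cons b l ih =>
    rw [CV, ih, Dsc_iff]
    constructor
    · rintro (⟨j, h, h'⟩ | ⟨i, j, h, h', h''⟩)
      · exact ⟨0, j + 1, by simpa using h, by simp, by simpa using h'⟩
      · exact ⟨i + 1, j + 1, by simpa using h, by simpa using h', by simpa using h''⟩
    · rintro ⟨i, j, h, h', h''⟩
      obtain ⟨j, rfl⟩ : ∃ k, j = k + 1 := ⟨j - 1, by omega⟩
      cases i with
      | zero => left; exact ⟨j, by simpa using h, by simpa using h''⟩
      | succ i =>
        right; exact ⟨i, j, by simpa using h, by simpa using h', by simpa using h''⟩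

theorem Inv_iff (x : ℕ) (l : List ℕ) :
    Inv231 x l ↔ ∃ j k, ∃ h : k < l.length, ∃ h' : j < k, l[k] < x ∧ x < l[j] := by
  induction l with
  | nil => simp [Inv231]
  | cons b l ih =>
    rw [Inv231, ih]
    constructor
    · rintro (⟨h, c, hc, h'⟩ | ⟨j, k, h, h', h''⟩)
      · obtain ⟨k, hk, rfl⟩ := List.getElem_of_mem hc
        exact ⟨0, k + 1, by simpa using hk, by simp, by simpa using ⟨h', h⟩⟩
      · exact ⟨j + 1, k + 1, by simpa using h, by simpa using h', by simpa using h''⟩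
    · rintro ⟨j, k, h, h', h''⟩
      obtain ⟨k, rfl⟩ : ∃ m, k = m + 1 := ⟨k - 1, by omega⟩
      cases j with
      | zero =>
        left
        simp only [List.getElem_cons_succ, List.getElem_cons_zero] at h''
        exact ⟨h''.2, _, List.getElem_mem _, h''.1⟩
      | succ j =>
        right; exact ⟨j, k, by simpa using h, by simpa using h', by simpa using h''⟩

theorem C231_iff (l : List ℕ) :
    C231 l ↔ ∃ i j k, ∃ h : k < l.length, ∃ h' : j < k, ∃ h'' : i < j,
      l[k] < l[i] ∧ l[i] < l[j] := by
  induction l with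
  | nil => simp [C231]
  | cons b l ih =>
    rw [C231, ih, Inv_iff]
    constructor
    · rintro (⟨j, k, h, h', h''⟩ | ⟨i, j, k, h, h', h'', h3⟩)
      · exact ⟨0, j + 1, k + 1, by simpa using h, by simpa using h', by simp, by simpa using h''⟩
      · exact ⟨i + 1, j + 1, k + 1, by simpa using h, by simpa using h', by simpa using h'',
          by simpa using h3⟩
    · rintro ⟨i, j, k, h, h', h'', h3⟩
      obtain ⟨k, rfl⟩ : ∃ m, k = m + 1 := ⟨k - 1, by omega⟩
      obtain ⟨j, rfl⟩ : ∃ m, j = m + 1 := ⟨j - 1, by omega⟩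
      cases i with
      | zero => left; exact ⟨j, k, by simpa using h, by simpa using h', by simpa using h3⟩
      | succ i =>
        right
        exact ⟨i, j, k, by simpa using h, by simpa using h', by simpa using h'', by simpa using h3⟩

theorem containsV_iff_CV (l : List ℕ) : ContainsV [3, 2, 1] {1} l ↔ CV l := by
  rw [CV_iff]
  constructor
  · rintro ⟨f, hf, ho, ha⟩
    have e := ha 1 rfl (by simp)
    have h01 : f (⟨0, by simp⟩ : Fin 3) < f (⟨1, by simp⟩ : Fin 3) := hf (by simp)
    have o1 := (ho (⟨2, by simp⟩ : Fin 3) (⟨1, by simp⟩ : Fin 3)).1 (by simp)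
    have o2 := (ho (⟨1, by simp⟩ : Fin 3) (⟨0, by simp⟩ : Fin 3)).1 (by simp)
    simp only [List.get_eq_getElem] at o1 o2
    refine ⟨(f (⟨0, by simp⟩ : Fin 3)).1, (f (⟨1, by simp⟩ : Fin 3)).1, ?_, h01, ?_, o2⟩
    · have := (f (⟨2, by simp⟩ : Fin 3)).2
      simp only [Nat.reduceAdd] at e
      omega
    · simp only [Nat.reduceAdd] at e
      simpa only [e] using o1
  · rintro ⟨i, j, h, h', h1, h2⟩
    refine ⟨(![⟨i, by omega⟩, ⟨j, by omega⟩, ⟨j + 1, h⟩] : Fin 3 → Fin l.length), ?_, ?_, ?_⟩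
    · rw [show (StrictMono (![⟨i, by omega⟩, ⟨j, by omega⟩, ⟨j + 1, h⟩] : Fin 3 → Fin l.length)) ↔ _ from Fin.strictMono_iff_lt_succ]
      intro a
      fin_cases a <;> simp [h']
    · intro a b
      change Fin 3 at a b
      fin_cases a <;> fin_cases b <;> simp <;> omega
    · rintro a rfl ha
      simp

theorem containsV_iff_C231 (l : List ℕ) : ContainsV [2, 3, 1] ∅ l ↔ C231 l := by
  rw [C231_iff]
  constructor
  · rintro ⟨f, hf, ho, -⟩
    have h01 : f (⟨0, by simp⟩ : Fin 3) < f (⟨1, by simp⟩ : Fin 3) := hf (by simp)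
    have h12 : f (⟨1, by simp⟩ : Fin 3) < f (⟨2, by simp⟩ : Fin 3) := hf (by simp)
    have o1 := (ho (⟨2, by simp⟩ : Fin 3) (⟨0, by simp⟩ : Fin 3)).1 (by simp)
    have o2 := (ho (⟨0, by simp⟩ : Fin 3) (⟨1, by simp⟩ : Fin 3)).1 (by simp)
    exact ⟨_, _, _, (f (⟨2, by simp⟩ : Fin 3)).2, h12, h01, o1, o2⟩
  · rintro ⟨i, j, k, h, h', h'', h1, h2⟩
    refine ⟨(![⟨i, by omega⟩, ⟨j, by omega⟩, ⟨k, h⟩] : Fin 3 → Fin l.length), ?_, ?_, ?_⟩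
    · rw [show (StrictMono (![⟨i, by omega⟩, ⟨j, by omega⟩, ⟨k, h⟩] : Fin 3 → Fin l.length)) ↔ _ from Fin.strictMono_iff_lt_succ]
      intro a
      fin_cases a <;> simp [h', h'']
    · intro a b
      change Fin 3 at a b
      fin_cases a <;> fin_cases b <;> simp <;> omega
    · rintro a ha
      simp at ha

theorem Inv_mono {x : ℕ} {l l' : List ℕ} (h : l.Sublist l') : Inv231 x l → Inv231 x l' := by
  induction h with
  | slnil => exact id
  | cons a h ih => intro H; exact Or.inr (ih H)
  | cons_cons a h ih =>
    rintro (⟨h1, c, hc, h2⟩ | H)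
    · exact Or.inl ⟨h1, c, h.subset hc, h2⟩
    · exact Or.inr (ih H)

theorem CV_append {l : List ℕ} (u : List ℕ) (h : CV l) : CV (u ++ l) := by
  induction u with
  | nil => exact h
  | cons a u ih => exact Or.inr ih

theorem sublist_scAux_s10 (σ : List ℕ) (A : Set ℕ) (s t : List ℕ) : s.Sublist (scAux σ A s t) := by
  induction s, t using scAux.induct (σ := σ) (A := A) with
  | case1 s => rw [scAux]
  | case2 x rest ih => simp
  | case3 y s x rest h ih =>
    rw [scAux, if_pos h]
    exact ih.cons_cons y
  | case4 y s x rest h ih =>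
    rw [scAux, if_neg h]
    exact (List.sublist_cons_self _ _).trans ih

theorem scAux_main_s10 (s t : List ℕ) (hs : ¬ CV s) :
    (¬ CV (t.reverse ++ s) ∧ scAux [3, 2, 1] {1} s t = t.reverse ++ s) ∨
    (CV (t.reverse ++ s) ∧ C231 (scAux [3, 2, 1] {1} s t)) := by
  induction s, t using scAux.induct (σ := [3, 2, 1]) (A := {1}) with
  | case1 s => left; rw [scAux]; simpa using hs
  | case2 x rest ih =>
    rw [scAux]
    simpa using ih (by simp [CV, Dsc])
  | case3 y s x rest h ih =>
    rw [scAux, if_pos h]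
    rw [containsV_iff_CV] at h
    right
    refine ⟨by simpa using CV_append rest.reverse h, ?_⟩
    by_cases hx : CV (x :: s)
    · rcases ih (fun h' => hs (Or.inr h')) with ⟨h1, -⟩ | ⟨-, h2⟩
      · exact absurd (by simpa using CV_append rest.reverse hx) h1
      · exact Or.inr h2
    · left
      have hd : Dsc x (y :: s) := h.resolve_right hs
      cases s with
      | nil => exact hd.elim
      | cons z s =>
        have hzy : z < y ∧ y < x := hd.resolve_right (fun h' => hx (Or.inl h'))
        rw [scAux, if_neg (by rwa [containsV_iff_CV])]
        exact Inv_mono (sublist_scAux_s10 _ _ _ _) (Or.inl ⟨hzy.2, z, by simp, hzy.1⟩)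
  | case4 y s x rest h ih =>
    rw [scAux, if_neg h]
    rw [containsV_iff_CV] at h
    simpa using ih h

def FF (s n : ℕ) : Set (List ℕ) :=
  {l | l.Perm (List.range' s n) ∧ ¬ CV l ∧ ¬ C231 l}

theorem sortSet_eq (n : ℕ) : SortSet [3, 2, 1] {1} n = List.reverse '' FF 1 n := by
  have key : ∀ t, ¬ C231 (sc [3, 2, 1] {1} t) ↔ ¬ CV t.reverse ∧ ¬ C231 t.reverse := by
    intro t
    have := scAux_main_s10 [] t (by simp [CV])
    simp only [List.append_nil] at this
    unfold sc
    rcases this with ⟨h1, h2⟩ | ⟨h1, h2⟩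
    · rw [h2]; tauto
    · tauto
  ext t
  simp only [SortSet, IsPermList, FF, Set.mem_ofPred_eq, Set.mem_image, containsV_iff_C231, key]
  constructor
  · rintro ⟨h1, h2⟩
    exact ⟨t.reverse, ⟨(List.reverse_perm t).trans h1, h2⟩, by simp⟩
  · rintro ⟨l, ⟨h1, h2⟩, rfl⟩
    exact ⟨(List.reverse_perm l).trans h1, by simpa using h2⟩

theorem Dsc_min {s : ℕ} {l : List ℕ} (h : ∀ a ∈ l, s < a) : ¬ Dsc s l := by
  rw [Dsc_iff]
  rintro ⟨j, hj, h1, h2⟩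
  have := h _ (List.getElem_mem (show j < l.length by omega))
  omega

theorem Inv_min {s : ℕ} {l : List ℕ} (h : ∀ a ∈ l, s < a) : ¬ Inv231 s l := by
  rw [Inv_iff]
  rintro ⟨j, k, hk, hj, h1, h2⟩
  have := h _ (List.getElem_mem hk)
  omega

theorem Dsc_cons_min {s x : ℕ} {l : List ℕ} (h : ∀ a ∈ l, s < a) : Dsc x (s :: l) ↔ Dsc x l := by
  cases l with
  | nil => simp [Dsc]
  | cons a l =>
    have := h a (by simp)
    rw [Dsc]
    constructor
    · rintro (h | h)
      · omega
      · exact h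
    · exact Or.inr

theorem far_min {s : ℕ} (m : List ℕ) : ∀ x y, s ∈ m → s < x → s < y → (x :: y :: m).Nodup →
    (∀ a ∈ m, s ≤ a) → CV (x :: y :: m) ∨ C231 (x :: y :: m) := by
  induction m with
  | nil => simp
  | cons z m ih =>
    intro x y hs hx hy hn hm
    by_cases hz : z = s
    · subst hz
      have : x ≠ y := by intro h; simp [h] at hn
      rcases lt_or_gt_of_ne this with h | h
      · right; left; left; exact ⟨h, z, by simp, hx⟩
      · left; left; left; exact ⟨hy, h⟩
    · have hsm : s ∈ m := by simpa [Ne.symm hz] using hs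
      have := hm z (by simp)
      rcases ih y z hsm hy (by omega) hn.of_cons (fun a ha => hm a (by simp [ha])) with h | h
      · left; right; exact h
      · right; right; exact h

def ins1 (s : ℕ) : List ℕ → List ℕ
  | [] => [s]
  | a :: l => a :: s :: l

theorem FF_succ (s n : ℕ) :
    FF s (n + 2) = List.cons s '' FF (s + 1) (n + 1) ∪ ins1 s '' FF (s + 1) (n + 1) := by
  ext l
  simp only [FF, Set.mem_ofPred_eq, Set.mem_union, Set.mem_image]
  have hr : List.range' s (n + 2) = s :: List.range' (s + 1) (n + 1) := by
    rw [List.range'_succ]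
  have hmin : ∀ l : List ℕ, l.Perm (List.range' (s + 1) (n + 1)) → ∀ a ∈ l, s < a := by
    intro l hl a ha
    have := hl.subset ha
    simp at this
    omega
  rw [hr]
  constructor
  · rintro ⟨hp, h1, h2⟩
    have hn : l.Nodup := hp.nodup_iff.2 (hr ▸ List.nodup_range')
    have hmem : s ∈ l := hp.symm.subset (by simp)
    have hge : ∀ a ∈ l, s ≤ a := by
      intro a ha
      have := hp.subset ha
      simp at this
      omega
    cases l with
    | nil => simp at hmem
    | cons x l =>
      by_cases hx : x = s
      · subst hx
        exact Or.inl ⟨l, ⟨hp.cons_inv, fun h => h1 (Or.inr h), fun h => h2 (Or.inr h)⟩, rfl⟩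
      · have hsx : s < x := lt_of_le_of_ne (hge x (by simp)) (Ne.symm hx)
        cases l with
        | nil => simp at hmem; omega
        | cons y l =>
          by_cases hy : y = s
          · subst hy
            right
            have hp' : (x :: l).Perm (List.range' (y + 1) (n + 1)) :=
              ((List.Perm.swap x y l).trans hp).cons_inv
            have hm := hmin _ hp'
            refine ⟨x :: l, ⟨hp', ?_, ?_⟩, rfl⟩
            · rintro (h | h)
              · exact h1 (Or.inl ((Dsc_cons_min (fun a ha => hm a (by simp [ha]))).2 h))
              · exact h1 (Or.inr (Or.inr h))
            · rintro (h | h)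
              · exact h2 (Or.inl (Or.inr h))
              · exact h2 (Or.inr (Or.inr h))
          · have hsy : s < y := lt_of_le_of_ne (hge y (by simp)) (Ne.symm hy)
            have hsl : s ∈ l := by simpa [Ne.symm hx, Ne.symm hy] using hmem
            rcases far_min l x y hsl hsx hsy hn (fun a ha => hge a (by simp [ha])) with h | h
            · exact absurd h h1
            · exact absurd h h2
  · rintro (⟨l, ⟨hp, h1, h2⟩, rfl⟩ | ⟨l, ⟨hp, h1, h2⟩, rfl⟩)
    · have hm := hmin _ hp
      exact ⟨hp.cons s, fun h => h.elim (Dsc_min hm) h1, fun h => h.elim (Inv_min hm) h2⟩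
    · have hm := hmin _ hp
      cases l with
      | nil => simp at hp
      | cons a l =>
        have hm' : ∀ b ∈ l, s < b := fun b hb => hm b (by simp [hb])
        have ha := hm a (by simp)
        refine ⟨(List.Perm.swap s a l).trans (hp.cons s), ?_, ?_⟩
        · rintro (h | h | h)
          · exact h1 (Or.inl ((Dsc_cons_min hm').1 h))
          · exact Dsc_min hm' h
          · exact h1 (Or.inr h)
        · rintro ((h | h) | h | h)
          · omega
          · exact h2 (Or.inl h)
          · exact Inv_min hm' h
          · exact h2 (Or.inr h)

theorem FF_finite (s n : ℕ) : (FF s n).Finite := by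
  apply (List.finite_toSet (List.range' s n).permutations).subset
  rintro l ⟨h, -⟩
  exact List.mem_permutations.2 h

theorem ins1_inj (s : ℕ) : Function.Injective (ins1 s) := by
  intro a b h
  cases a <;> cases b <;> simp_all [ins1]

theorem FF_card (n : ℕ) : ∀ s, (FF s (n + 1)).ncard = 2 ^ n := by
  induction n with
  | zero =>
    intro s
    have : FF s 1 = {[s]} := by
      ext l
      simp only [FF, Set.mem_ofPred_eq, Set.mem_singleton_iff, List.range'_one, List.perm_singleton]
      constructor
      · exact fun h => h.1
      · rintro rfl
        simp [CV, C231, Dsc, Inv231]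
    rw [zero_add, this]
    simp
  | succ n ih =>
    intro s
    rw [FF_succ, Set.ncard_union_eq _ ((FF_finite _ _).image _) ((FF_finite _ _).image _),
      Set.ncard_image_of_injective _ (List.cons_injective),
      Set.ncard_image_of_injective _ (ins1_inj s), ih, pow_succ]
    · omega
    · rw [Set.disjoint_left]
      rintro _ ⟨l, hl, rfl⟩ ⟨m, hm, he⟩
      cases m with
      | nil => simpa using hm.1
      | cons a m =>
        simp only [ins1, List.cons.injEq] at he
        have := hm.1.subset (show a ∈ a :: m by simp)
        simp at this
        omega

/-- |Sort_n(sc_{3\un{21}})| = 2^(n-1) for n ≥ 1. -/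
theorem card_sortingClass_3un21 (n : ℕ) (hn : 1 ≤ n) :
    (SortSet [3, 2, 1] {1} n).ncard = 2 ^ (n - 1) := by
  obtain ⟨m, rfl⟩ : ∃ m, n = m + 1 := ⟨n - 1, by omega⟩
  rw [sortSet_eq, Set.ncard_image_of_injective _ List.reverse_injective, FF_card]
  simp
end

section
/- For every n, the sorting class of the \underline{23}1-avoiding stack-sorting map equals the set of permutations of length n avoiding the classical pattern 1324 and the mesh pattern μ_{2413}; that is, Sort_n(sc_{\underline{23}1}) = Av_n(1324, μ_{2413}). -/
/-- `τ` contains the mesh pattern `μ_{2413} = (2413, {(1,0), (2,1), (2,2)})`. -/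
def ContainsMu2413 (τ : List ℕ) : Prop :=
  ∃ i₁ i₂ i₃ i₄ : Fin τ.length, i₁ < i₂ ∧ i₂ < i₃ ∧ i₃ < i₄ ∧
    τ.get i₃ < τ.get i₁ ∧ τ.get i₁ < τ.get i₄ ∧ τ.get i₄ < τ.get i₂ ∧
    (¬ ∃ j : Fin τ.length, i₁ < j ∧ j < i₂ ∧ τ.get j < τ.get i₃) ∧
    (¬ ∃ j : Fin τ.length, i₂ < j ∧ j < i₃ ∧ τ.get i₃ < τ.get j ∧ τ.get j < τ.get i₁) ∧
    (¬ ∃ j : Fin τ.length, i₂ < j ∧ j < i₃ ∧ τ.get i₁ < τ.get j ∧ τ.get j < τ.get i₄)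

theorem cV231A (L : List ℕ) : ContainsV [2, 3, 1] {0} L ↔
    ∃ i k, i + 1 < k ∧ k < L.length ∧ L.getD k 0 < L.getD i 0 ∧ L.getD i 0 < L.getD (i+1) 0 := by
  constructor
  · rintro ⟨f, hf, ho, ha⟩
    have h0 := ha 0 (by simp) (by simp)
    have h12 : f 1 < f 2 := hf (by decide)
    have e1 := (ho 2 0).1 (by decide)
    have e2 := (ho 0 1).1 (by decide)
    have h0' : (f 1 : ℕ) = f 0 + 1 := h0
    refine ⟨f 0, f 2, by rw [← h0']; exact h12, (f 2).2, ?_, ?_⟩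
    · simpa [List.getD_eq_getElem] using e1
    · rw [← h0']
      simpa [List.getD_eq_getElem] using e2
  · rintro ⟨i, k, hik, hk, h1, h2⟩
    rw [List.getD_eq_getElem _ _ (by omega), List.getD_eq_getElem _ _ (by omega)] at h1 h2
    refine ⟨![⟨i, by omega⟩, ⟨i+1, by omega⟩, ⟨k, hk⟩], ?_, ?_, ?_⟩
    · intro a b hab
      fin_cases a <;> fin_cases b <;> simp_all <;> omega
    · intro a b
      fin_cases a <;> fin_cases b <;> simp_all <;> omega
    · rintro a rfl h
      rfl

theorem cV231 (L : List ℕ) : ContainsV [2, 3, 1] ∅ L ↔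
    ∃ i j k, i < j ∧ j < k ∧ k < L.length ∧ L.getD k 0 < L.getD i 0 ∧ L.getD i 0 < L.getD j 0 := by
  constructor
  · rintro ⟨f, hf, ho, -⟩
    have h01 : f 0 < f 1 := hf (by decide)
    have h12 : f 1 < f 2 := hf (by decide)
    have e1 := (ho 2 0).1 (by decide)
    have e2 := (ho 0 1).1 (by decide)
    refine ⟨f 0, f 1, f 2, h01, h12, (f 2).2, ?_, ?_⟩
    · simpa [List.getD_eq_getElem] using e1
    · simpa [List.getD_eq_getElem] using e2
  · rintro ⟨i, j, k, hij, hjk, hk, h1, h2⟩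
    rw [List.getD_eq_getElem _ _ (by omega), List.getD_eq_getElem _ _ (by omega)] at h1 h2
    refine ⟨![⟨i, by omega⟩, ⟨j, by omega⟩, ⟨k, hk⟩], ?_, ?_, ?_⟩
    · intro a b hab
      fin_cases a <;> fin_cases b <;> simp_all <;> omega
    · intro a b
      fin_cases a <;> fin_cases b <;> simp_all <;> omega
    · simp

theorem cV1324 (L : List ℕ) : ContainsV [1, 3, 2, 4] ∅ L ↔
    ∃ i j k l, i < j ∧ j < k ∧ k < l ∧ l < L.length ∧ L.getD i 0 < L.getD k 0 ∧
      L.getD k 0 < L.getD j 0 ∧ L.getD j 0 < L.getD l 0 := by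
  constructor
  · rintro ⟨f, hf, ho, -⟩
    have h01 : f 0 < f 1 := hf (by decide)
    have h12 : f 1 < f 2 := hf (by decide)
    have h23 : f 2 < f 3 := hf (by decide)
    have e1 := (ho 0 2).1 (by decide)
    have e2 := (ho 2 1).1 (by decide)
    have e3 := (ho 1 3).1 (by decide)
    refine ⟨f 0, f 1, f 2, f 3, h01, h12, h23, (f 3).2, ?_, ?_, ?_⟩
    · simpa [List.getD_eq_getElem] using e1
    · simpa [List.getD_eq_getElem] using e2
    · simpa [List.getD_eq_getElem] using e3
  · rintro ⟨i, j, k, l, hij, hjk, hkl, hl, h1, h2, h3⟩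
    rw [List.getD_eq_getElem _ _ (by omega), List.getD_eq_getElem _ _ (by omega)] at h1 h2 h3
    refine ⟨![⟨i, by omega⟩, ⟨j, by omega⟩, ⟨k, by omega⟩, ⟨l, hl⟩], ?_, ?_, ?_⟩
    · intro a b hab
      fin_cases a <;> fin_cases b <;> simp_all <;> omega
    · intro a b
      fin_cases a <;> fin_cases b <;> simp_all <;> omega
    · simp

theorem cMu (L : List ℕ) : ContainsMu2413 L ↔
    ∃ a b c d, a < b ∧ b < c ∧ c < d ∧ d < L.length ∧ L.getD c 0 < L.getD a 0 ∧
      L.getD a 0 < L.getD d 0 ∧ L.getD d 0 < L.getD b 0 ∧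
      (∀ j, a < j → j < b → ¬ L.getD j 0 < L.getD c 0) ∧
      (∀ j, b < j → j < c → ¬ (L.getD c 0 < L.getD j 0 ∧ L.getD j 0 < L.getD a 0)) ∧
      (∀ j, b < j → j < c → ¬ (L.getD a 0 < L.getD j 0 ∧ L.getD j 0 < L.getD d 0)) := by
  have g : ∀ i : Fin L.length, L.get i = L.getD i 0 := by
    intro i; simp [List.getD_eq_getElem]
  constructor
  · rintro ⟨a, b, c, d, h1, h2, h3, h4, h5, h6, h7, h8, h9⟩
    simp only [g] at *
    refine ⟨a, b, c, d, h1, h2, h3, d.2, h4, h5, h6, ?_, ?_, ?_⟩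
    · intro j hj hj' h
      exact h7 ⟨⟨j, hj'.trans b.2⟩, hj, hj', h⟩
    · intro j hj hj' h
      exact h8 ⟨⟨j, hj'.trans c.2⟩, hj, hj', h⟩
    · intro j hj hj' h
      exact h9 ⟨⟨j, hj'.trans c.2⟩, hj, hj', h⟩
  · rintro ⟨a, b, c, d, h1, h2, h3, hd, h4, h5, h6, h7, h8, h9⟩
    refine ⟨⟨a, by omega⟩, ⟨b, by omega⟩, ⟨c, by omega⟩, ⟨d, hd⟩, h1, h2, h3, ?_⟩
    simp only [g]
    refine ⟨h4, h5, h6, ?_, ?_, ?_⟩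
    · rintro ⟨j, hj, hj', h⟩
      exact h7 j hj hj' h
    · rintro ⟨j, hj, hj', h⟩
      exact h8 j hj hj' h
    · rintro ⟨j, hj, hj', h⟩
      exact h9 j hj hj' h

theorem cA_cons (x y : ℕ) (s : List ℕ) : ContainsV [2, 3, 1] {0} (x :: y :: s) ↔
    (x < y ∧ ∃ w ∈ s, w < x) ∨ ContainsV [2, 3, 1] {0} (y :: s) := by
  rw [cV231A, cV231A]
  constructor
  · rintro ⟨i, k, h1, h2, h3, h4⟩
    obtain ⟨k, rfl⟩ : ∃ k', k = k' + 1 := ⟨k - 1, by omega⟩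
    rcases i with _ | i
    · left
      obtain ⟨k, rfl⟩ : ∃ k', k = k' + 1 := ⟨k - 1, by omega⟩
      simp at h2 h3 h4
      refine ⟨h4, s[k], List.getElem_mem _, ?_⟩
      simpa [h2] using h3
    · right
      refine ⟨i, k, by omega, by simpa using h2, by simpa using h3, by simpa using h4⟩
  · rintro (⟨h, w, hw, hwx⟩ | ⟨i, k, h1, h2, h3, h4⟩)
    · obtain ⟨k, hk, rfl⟩ := List.mem_iff_getElem.1 hw
      refine ⟨0, k + 2, by omega, by simpa using hk, ?_, by simpa using h⟩
      simpa [hk] using hwx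
    · refine ⟨i + 1, k + 1, by omega, by simpa using h2, by simpa using h3, by simpa using h4⟩

theorem cA_single (x : ℕ) : ¬ ContainsV [2, 3, 1] {0} [x] := by
  rw [cV231A]
  rintro ⟨i, k, h1, h2, -⟩
  simp at h2; omega

theorem sc_step (x : ℕ) (r : List ℕ) (S : List ℕ) (hS : ¬ ContainsV [2, 3, 1] {0} S) :
    ∃ pre S', S = pre ++ S' ∧
      scAux [2, 3, 1] {0} S (x :: r) = pre ++ scAux [2, 3, 1] {0} (x :: S') r ∧
      (∀ u ∈ pre, x < u) ∧ (pre ≠ [] → ∃ w ∈ S', w < x) ∧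
      ¬ ContainsV [2, 3, 1] {0} (x :: S') ∧
      (∀ u s, S' = u :: s → x < u → ∀ w ∈ s, ¬ w < x) := by
  induction S with
  | nil =>
    refine ⟨[], [], rfl, by simp [scAux], by simp, by simp, cA_single x, by simp⟩
  | cons y s ih =>
    by_cases h : ContainsV [2, 3, 1] {0} (x :: y :: s)
    · have h' := (cA_cons x y s).1 h
      have h2 := h'.resolve_right hS
      have hs : ¬ ContainsV [2, 3, 1] {0} s := by
        rcases s with _ | ⟨z, s⟩
        · simp at h2
        · intro hc; exact hS ((cA_cons _ _ _).2 (Or.inr hc))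
      obtain ⟨pre, S', e, e2, h3, h4, h5, h6⟩ := ih hs
      refine ⟨y :: pre, S', by simp [e], ?_, ?_, ?_, h5, h6⟩
      · rw [scAux, if_pos h, e2]; rfl
      · intro u hu
        rcases List.mem_cons.1 hu with rfl | hu
        · exact h2.1
        · exact h3 u hu
      · intro _
        obtain ⟨-, w, hw, hwx⟩ := h2
        rw [e] at hw
        rcases List.mem_append.1 hw with hw | hw
        · have := h3 w hw; omega
        · exact ⟨w, hw, hwx⟩
    · refine ⟨[], y :: s, rfl, ?_, by simp, by simp, h, ?_⟩
      · rw [scAux, if_neg h]; rfl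
      · rintro u s' ⟨⟩ hxu w hw hwx
        exact h ((cA_cons _ _ _).2 (Or.inl ⟨hxu, w, hw, hwx⟩))

/-- Entry `j` has been popped by the time the first `k` entries are processed. -/
def Popped (t : ℕ → ℕ) (k j : ℕ) : Prop :=
  ∃ i l, i < j ∧ j < l ∧ l < k ∧ t i < t l ∧ t l < t j ∧ ∀ q, j < q → q < l → t i ≤ t q

/-- Output order of entries. -/
def OutRel (t : ℕ → ℕ) (a b : ℕ) : Prop :=
  (a < b ∧ Popped t (b + 1) a) ∨ (b < a ∧ ¬ Popped t (a + 1) b)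

theorem exists_min_s11 (t : ℕ → ℕ) (k : ℕ) (hk : 0 < k) : ∃ m < k, ∀ i < k, t m ≤ t i := by
  obtain ⟨m, hm, h⟩ := Finset.exists_min_image (Finset.range k) t ⟨0, by simpa⟩
  exact ⟨m, by simpa using hm, fun i hi => h i (by simpa using hi)⟩

set_option maxHeartbeats 1000000 in
theorem inv (τ : List ℕ) (t : ℕ → ℕ) (ht : t = fun i => τ.getD i 0)
    (inj : ∀ i < τ.length, ∀ j < τ.length, t i = t j → i = j) (k : ℕ) (hk : k ≤ τ.length) :
    ∃ Q J : List ℕ,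
      scAux [2, 3, 1] {0} [] τ = Q.map t ++ scAux [2, 3, 1] {0} (J.map t) (τ.drop k) ∧
      (∀ x, x ∈ Q ++ J ↔ x < k) ∧ J.Pairwise (· > ·) ∧
      (∀ x, x ∈ Q → Popped t k x) ∧ (∀ x, x ∈ J → ¬ Popped t k x) ∧
      (Q ++ J).Pairwise (OutRel t) ∧ ¬ ContainsV [2, 3, 1] {0} (J.map t) := by
  induction k with
  | zero =>
    refine ⟨[], [], by simp, by simp, by simp, by simp, by simp, by simp, ?_⟩
    rw [cV231A]; simp
  | succ k ih =>
    obtain ⟨Q, J, h1, h2, h3, h4, h5, h6, h7⟩ := ih (by omega)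
    have hd : τ.drop k = t k :: τ.drop (k + 1) := by
      rw [List.drop_eq_getElem_cons (by omega)]
      simp [ht, List.getD_eq_getElem, show k < τ.length by omega]
    obtain ⟨pre', S', e, e2, p1, p2, p3, p4⟩ := sc_step (t k) (τ.drop (k + 1)) _ h7
    obtain ⟨pre, J', rfl, rfl, rfl⟩ := List.map_eq_append_iff.1 e
    have hlt : ∀ x, x ∈ Q ∨ x ∈ pre ∨ x ∈ J' ↔ x < k := by
      intro x; rw [← h2]; simp
    have hmin : 0 < k → ∃ m < k, (∀ i < k, t m ≤ t i) ∧ (m ∈ pre ∨ m ∈ J') := by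
      intro h
      obtain ⟨m, hm, h⟩ := exists_min_s11 t k h
      refine ⟨m, hm, h, ?_⟩
      rcases (hlt m).2 hm with hq | hq
      · obtain ⟨i, l, q1, q2, q3, q4, q5, -⟩ := h4 m hq
        have := h i (by omega)
        omega
      · exact hq
    rw [List.pairwise_append] at h3
    have hpreP : ∀ x ∈ pre, Popped t (k + 1) x := by
      intro x hx
      have hxk := (hlt x).1 (Or.inr (Or.inl hx))
      obtain ⟨m, hm, hm1, hm2⟩ := hmin (by omega)
      obtain ⟨w', hw', hwk⟩ := p2 (List.ne_nil_of_mem (List.mem_map_of_mem hx))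
      obtain ⟨w, hw, rfl⟩ := List.mem_map.1 hw'
      have hwk' := (hlt w).1 (Or.inr (Or.inr hw))
      have hmw := hm1 w hwk'
      have hmJ : m ∈ J' := by
        rcases hm2 with h | h
        · have := p1 _ (List.mem_map_of_mem h); omega
        · exact h
      have := h3.2.2 x hx m hmJ
      have := p1 _ (List.mem_map_of_mem hx)
      exact ⟨m, k, by omega, by omega, by omega, by omega, by omega, fun q _ hq => hm1 q hq⟩
    have hJP : ∀ x ∈ J', ¬ Popped t (k + 1) x := by
      rintro x hx ⟨i, l, q1, q2, q3, q4, q5, q6⟩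
      have hxP := h5 x (by simp [hx])
      rcases Nat.lt_or_ge l k with hl | hl
      · exact hxP ⟨i, l, q1, q2, hl, q4, q5, q6⟩
      obtain rfl : l = k := by omega
      obtain ⟨m, hm, hm1, hm2⟩ := hmin (by omega)
      have hmi := hm1 i (by omega)
      have hmJ : m ∈ J' := by
        rcases hm2 with h | h
        · have := p1 _ (List.mem_map_of_mem h); omega
        · exact h
      rcases J' with _ | ⟨u, s⟩
      · simp at hx
      have p4' := p4 (t u) (s.map t) (by simp)
      have huk : u < l := (hlt u).1 (by simp)
      by_cases hu : t l < t u
      · rcases List.mem_cons.1 hmJ with rfl | hms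
        · omega
        · exact p4' hu _ (List.mem_map_of_mem hms) (by omega)
      · have hux : x < u := by
          rcases List.mem_cons.1 hx with rfl | hxs
          · omega
          · exact (List.pairwise_cons.1 h3.2.1).1 x hxs
        have hiu := q6 u hux huk
        have : t i ≠ t u := fun h => by
          have := inj i (by omega) u (by omega) h
          omega
        have : t l ≠ t u := fun h => by
          have := inj l (by omega) u (by omega) h
          omega
        exact hxP ⟨i, u, q1, hux, huk, by omega, by omega, fun q a b => q6 q a (by omega)⟩
    have hQP : ∀ x ∈ Q, Popped t (k + 1) x := by
      intro x hx
      obtain ⟨i, l, q1, q2, q3, q⟩ := h4 x hx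
      exact ⟨i, l, q1, q2, by omega, q⟩
    refine ⟨Q ++ pre, k :: J', ?_, ?_, ?_, ?_, ?_, ?_, ?_⟩
    · rw [h1, hd, e2]; simp
    · intro x
      have := hlt x
      simp only [List.mem_append, List.mem_cons]
      constructor
      · rintro ((h | h) | h | h)
        · have := this.1 (Or.inl h); omega
        · have := this.1 (Or.inr (Or.inl h)); omega
        · omega
        · have := this.1 (Or.inr (Or.inr h)); omega
      · intro h
        by_cases hx : x = k
        · simp [hx]
        · have := this.2 (by omega)
          tauto
    · rw [List.pairwise_cons]
      refine ⟨fun a ha => (hlt a).1 (by simp [ha]), h3.2.1⟩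
    · intro x hx
      rcases List.mem_append.1 hx with hx | hx
      · exact hQP x hx
      · exact hpreP x hx
    · intro x hx
      rcases List.mem_cons.1 hx with rfl | hx
      · rintro ⟨i, l, q1, q2, q3, -⟩; omega
      · exact hJP x hx
    · rw [← List.append_assoc, List.pairwise_append] at h6
      rw [List.pairwise_append]
      refine ⟨h6.1, ?_, ?_⟩
      · rw [List.pairwise_cons]
        exact ⟨fun a ha => Or.inr ⟨(hlt a).1 (by simp [ha]), hJP a ha⟩, h6.2.1⟩
      · intro a ha b hb
        rcases List.mem_cons.1 hb with rfl | hb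
        · left
          rcases List.mem_append.1 ha with ha | ha
          · exact ⟨(hlt a).1 (by simp [ha]), hQP a ha⟩
          · exact ⟨(hlt a).1 (by simp [ha]), hpreP a ha⟩
        · exact h6.2.2 a ha b hb
    · simpa using p3

/-- The order characterization of 231 in the output. -/
theorem out231 (τ : List ℕ) (t : ℕ → ℕ) (ht : t = fun i => τ.getD i 0)
    (inj : ∀ i < τ.length, ∀ j < τ.length, t i = t j → i = j) :
    ContainsV [2, 3, 1] ∅ (sc [2, 3, 1] {0} τ) ↔
    ∃ a b c, a < τ.length ∧ b < τ.length ∧ c < τ.length ∧ t a < t b ∧ t b < t c ∧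
      OutRel t b c ∧ OutRel t c a := by
  obtain ⟨Q, J, h1, h2, -, -, -, h6, -⟩ := inv τ t ht inj τ.length le_rfl
  obtain ⟨K, hK⟩ : ∃ K, K = Q ++ J := ⟨_, rfl⟩
  have e : sc [2, 3, 1] {0} τ = K.map t := by
    rw [sc, h1, hK]; simp [scAux]
  rw [← hK] at h2 h6
  rw [e, cV231]
  have g : ∀ i, i < K.length → (K.map t).getD i 0 = t (K.getD i 0) := by
    intro i hi; simp [hi]
  have hmem : ∀ i, i < K.length → K.getD i 0 < τ.length := by
    intro i hi; rw [← h2]; simp [hi]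
  have hrel : ∀ i j, i < j → j < K.length → OutRel t (K.getD i 0) (K.getD j 0) := by
    intro i j hij hj
    have := List.pairwise_iff_getElem.1 h6 i j (by omega) hj hij
    simpa [hj, show i < K.length by omega] using this
  have hidx : ∀ x, x < τ.length → ∃ i, i < K.length ∧ K.getD i 0 = x := by
    intro x hx
    obtain ⟨i, hi, rfl⟩ := List.mem_iff_getElem.1 ((h2 x).2 hx)
    exact ⟨i, hi, by simp [hi]⟩
  constructor
  · rintro ⟨i, j, k, hij, hjk, hk, q1, q2⟩
    simp only [List.length_map] at hk
    rw [g _ (by omega), g _ (by omega)] at q1 q2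
    exact ⟨K.getD k 0, K.getD i 0, K.getD j 0, hmem _ (by omega), hmem _ (by omega),
      hmem _ (by omega), q1, q2, hrel _ _ hij (by omega), hrel _ _ hjk (by omega)⟩
  · rintro ⟨a, b, c, ha, hb, hc, q1, q2, r1, r2⟩
    obtain ⟨k, hk, rfl⟩ := hidx a ha
    obtain ⟨i, hi, rfl⟩ := hidx b hb
    obtain ⟨j, hj, rfl⟩ := hidx c hc
    have asym : ∀ i j, i < K.length → j < K.length → OutRel t (K.getD i 0) (K.getD j 0) →
        i < j := by
      intro i j hi hj h
      by_contra hc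
      rcases Nat.lt_or_ge j i with h' | h'
      · have := hrel j i h' hi
        unfold OutRel at h this
        rcases h with h | h <;> rcases this with h' | h'
        · omega
        · exact h'.2 h.2
        · exact h.2 h'.2
        · omega
      · obtain rfl : i = j := by omega
        unfold OutRel at h; omega
    refine ⟨i, j, k, asym _ _ hi hj r1, asym _ _ hj hk r2, by simpa, ?_, ?_⟩
    · rw [g _ hk, g _ hi]; exact q1
    · rw [g _ hj, g _ hi]; exact q2

theorem exists_first (P : ℕ → Prop) (a b : ℕ) (hab : a < b) (hb : P b) :
    ∃ z, a < z ∧ z ≤ b ∧ P z ∧ ∀ q, a < q → q < z → ¬ P q := by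
  classical
  have hex : ∃ z, a < z ∧ P z := ⟨b, hab, hb⟩
  refine ⟨Nat.find hex, (Nat.find_spec hex).1, Nat.find_min' hex ⟨hab, hb⟩,
    (Nat.find_spec hex).2, ?_⟩
  intro q h1 h2 h3
  exact Nat.find_min hex h2 ⟨h1, h3⟩

/-- If `x` is not popped but has a later smaller entry, the first one is a left-to-right minimum. -/
theorem not_popped (t : ℕ → ℕ) (n : ℕ) (inj : ∀ i < n, ∀ j < n, t i = t j → i = j)
    (k x y : ℕ) (hk : k ≤ n) (hxy : x < y) (hy : y < k) (hlt : t y < t x) (hP : ¬ Popped t k x) :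
    ∃ z, x < z ∧ z ≤ y ∧ t z < t x ∧ (∀ q, x < q → q < z → t x < t q) ∧
      ∀ q, q < z → t z < t q := by
  obtain ⟨z, h1, h2, h3, h4⟩ := exists_first (fun q => t q < t x) x y hxy hlt
  have h5 : ∀ q, x < q → q < z → t x < t q := by
    intro q a b
    have := h4 q a b
    have : t x ≠ t q := fun h => by
      have := inj x (by omega) q (by omega) h
      omega
    omega
  refine ⟨z, h1, h2, h3, h5, ?_⟩
  intro q hq
  rcases lt_trichotomy q x with h | rfl | h
  · by_contra hc
    have : t z ≠ t q := fun h => by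
      have := inj z (by omega) q (by omega) h
      omega
    exact hP ⟨q, z, h, h1, by omega, by omega, h3, fun r a b => by have := h5 r a b; omega⟩
  · exact h3
  · have := h5 q h hq; omega

theorem min_not_popped (t : ℕ → ℕ) (k x : ℕ) (h : ∀ q, q < x → t x ≤ t q) : ¬ Popped t k x := by
  rintro ⟨i, l, q1, q2, q3, q4, q5, -⟩
  have := h i q1
  omega

theorem popped_mono (t : ℕ → ℕ) (k k' x : ℕ) (h : k ≤ k') (hp : Popped t k x) :
    Popped t k' x := by
  obtain ⟨i, l, q1, q2, q3, q⟩ := hp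
  exact ⟨i, l, q1, q2, by omega, q⟩

theorem comb (t : ℕ → ℕ) (n : ℕ) (inj : ∀ i < n, ∀ j < n, t i = t j → i = j) :
    (∃ a b c, a < n ∧ b < n ∧ c < n ∧ t a < t b ∧ t b < t c ∧
      OutRel t b c ∧ OutRel t c a) ↔
    (∃ i j k l, i < j ∧ j < k ∧ k < l ∧ l < n ∧ t i < t k ∧ t k < t j ∧ t j < t l) ∨
    (∃ a b c d, a < b ∧ b < c ∧ c < d ∧ d < n ∧ t c < t a ∧ t a < t d ∧ t d < t b ∧
      (∀ j, a < j → j < b → ¬ t j < t c) ∧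
      (∀ j, b < j → j < c → ¬ (t c < t j ∧ t j < t a)) ∧
      (∀ j, b < j → j < c → ¬ (t a < t j ∧ t j < t d))) := by
  constructor
  · rintro ⟨a, b, c, ha, hb, hc, hab, hbc, r1, r2⟩
    rcases r1 with ⟨hlt, i, l, q1, q2, q3, q4, q5, -⟩ | ⟨hlt, hP⟩
    · left
      have : l ≠ c := by rintro rfl; omega
      exact ⟨i, b, l, c, q1, q2, by omega, hc, q4, q5, hbc⟩
    · obtain ⟨z, z1, z2, z3, z4, z5⟩ := not_popped t n inj (b+1) c b (by omega) hlt (by omega) hbc hP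
      rcases r2 with ⟨hca, hQ⟩ | ⟨hac, hQ⟩
      · exfalso
        obtain ⟨i, l, q1, q2, q3, q4, q5, q6⟩ := hQ
        have hzl : z ≤ l := by
          by_contra h
          have := z4 l q2 (by omega)
          omega
        have := z5 i (by omega)
        rcases Nat.lt_or_ge z l with h | h
        · have := q6 z z1 h; omega
        · obtain rfl : z = l := by omega
          omega
      · right
        have hza := z5 a (by omega)
        have hzb : z ≠ b := by rintro rfl; omega
        refine ⟨a, c, z, b, hac, z1, by omega, hb, hza, hab, hbc, ?_, ?_, ?_⟩
        · intro j _ hj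
          have := z5 j (by omega)
          omega
        · intro j h1 h2
          have := z4 j h1 h2
          omega
        · intro j h1 h2
          have := z4 j h1 h2
          omega
  · rintro (⟨i, j, k, l, hij, hjk, hkl, hl, q1, q2, q3⟩ |
      ⟨a, b, c, d, hab, hbc, hcd, hd, q1, q2, q3, m1, m2, m3⟩)
    · obtain ⟨m, hm, hmin⟩ := exists_min_s11 t (i + 1) (by omega)
      have hmi := hmin i (by omega)
      have hmP : ∀ k, ¬ Popped t k m := fun k =>
        min_not_popped t k m (fun q hq => hmin q (by omega))
      by_cases hP : Popped t (l + 1) j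
      · exact ⟨m, j, l, by omega, by omega, hl, by omega, q3, Or.inl ⟨by omega, hP⟩,
          Or.inr ⟨by omega, hmP _⟩⟩
      · exact ⟨m, k, j, by omega, by omega, by omega, by omega, q2,
          Or.inr ⟨hjk, fun h => hP (popped_mono t _ _ _ (by omega) h)⟩,
          Or.inr ⟨by omega, hmP _⟩⟩
    · by_cases hP : Popped t (d + 1) a
      · obtain ⟨m, hm, hmin⟩ := exists_min_s11 t (c + 1) (by omega)
        have hmc := hmin c (by omega)
        exact ⟨m, a, d, by omega, by omega, hd, by omega, q2, Or.inl ⟨by omega, hP⟩,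
          Or.inr ⟨by omega, min_not_popped t _ m (fun q hq => hmin q (by omega))⟩⟩
      · obtain ⟨z, z1, z2, z3, z4, z5⟩ :=
          not_popped t n inj (d+1) a c (by omega) (by omega) (by omega) q1 hP
        -- choose the last large entry before the first entry below `t d` after `b`
        obtain ⟨y, y1, y2, y3, y4⟩ := exists_first (fun q => t q < t d) b c hbc (by omega)
        have hyc : t y ≤ t c := by
          rcases Nat.lt_or_ge y c with h | h
          · have e1 := m2 y y1 h
            have e2 := m3 y y1 h
            have : t a ≠ t y := fun h => by
              have := inj a (by omega) y (by omega) h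
              omega
            omega
          · obtain rfl : y = c := by omega
            exact le_rfl
        -- `y` is a left-to-right minimum
        have ymin : ∀ q, q < y → t y ≤ t q := by
          intro q hq
          rcases lt_trichotomy q a with h | rfl | h
          · rcases Nat.lt_or_ge z y with hz | hz
            · have hzb : z ≤ b := by
                by_contra h'
                exact y4 z (by omega) hz (by omega)
              have : z ≠ b := by rintro rfl; omega
              have := m1 z z1 (by omega)
              have := z5 q (by omega)
              omega
            · rcases Nat.lt_or_ge y z with hz' | hz'
              · have := z4 y (by omega) hz'
                omega
              · obtain rfl : z = y := by omega
                have := z5 q (by omega)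
                omega
          · omega
          · rcases lt_trichotomy q b with h' | rfl | h'
            · have := m1 q h h'; omega
            · omega
            · have := y4 q h' hq; omega
        -- the minimum among positions in `[b, y)` 
        obtain ⟨x, x1, x2⟩ := Finset.exists_min_image (Finset.Ico b y) t ⟨b, by simp; omega⟩
        simp only [Finset.mem_Ico] at x1 x2
        have hxd : t d < t x := by
          rcases Nat.lt_or_ge b x with h | h
          · have := y4 x h x1.2
            have : t d ≠ t x := fun h => by
              have := inj d (by omega) x (by omega) h
              omega
            omega
          · obtain rfl : x = b := by omega
            exact q3
        have hxP : ¬ Popped t (d + 1) x := by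
          rintro ⟨i, l, p1, p2, p3, p4, p5, p6⟩
          rcases Nat.lt_or_ge l y with h | h
          · have := x2 l ⟨by omega, h⟩; omega
          · have := ymin i (by omega)
            rcases Nat.lt_or_ge y l with h' | h'
            · have := p6 y (by omega) h'
              have : t i ≠ t y := fun h => by
                have := inj i (by omega) y (by omega) h
                omega
              omega
            · obtain rfl : l = y := by omega
              omega
        exact ⟨a, d, x, by omega, hd, by omega, q2, hxd, Or.inr ⟨by omega, hxP⟩,
          Or.inr ⟨by omega, fun h => hP (popped_mono t _ _ _ (by omega) h)⟩⟩

/-- Sort_n(sc_{\un{23}1}) = Av_n(1324, μ_{2413}). -/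
theorem sortingClass_un231 (n : ℕ) :
    SortSet [2, 3, 1] {0} n =
      {τ | IsPermList n τ ∧ ¬ ContainsV [1, 3, 2, 4] ∅ τ ∧ ¬ ContainsMu2413 τ} := by
  ext τ
  simp only [SortSet, Set.mem_setOf_eq]
  refine and_congr_right fun hτ => ?_
  have nd : τ.Nodup := hτ.nodup_iff.2 List.nodup_range'
  have inj : ∀ i < τ.length, ∀ j < τ.length,
      (fun i => τ.getD i 0) i = (fun i => τ.getD i 0) j → i = j := by
    intro i hi j hj h
    simp only [List.getD_eq_getElem _ _ hi, List.getD_eq_getElem _ _ hj] at h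
    exact (nd.getElem_inj_iff).1 h
  rw [out231 τ _ rfl inj, comb _ _ inj, cV1324, cMu, not_or]
end

section
/- For every n, the sorting class of the \underline{13}2-avoiding stack-sorting map equals the set of permutations of length n avoiding the classical pattern 2314 and the mesh pattern μ_{132}; that is, Sort_n(sc_{\underline{13}2}) = Av_n(2314, μ_{132}). -/
/-- `τ` contains the mesh pattern `μ_{132} = (132, {(0,2), (2,0), (2,1)})`. -/
def ContainsMu132 (τ : List ℕ) : Prop :=
  ∃ i₁ i₂ i₃ : Fin τ.length, i₁ < i₂ ∧ i₂ < i₃ ∧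
    τ.get i₁ < τ.get i₃ ∧ τ.get i₃ < τ.get i₂ ∧
    (¬ ∃ j : Fin τ.length, j < i₁ ∧ τ.get i₃ < τ.get j ∧ τ.get j < τ.get i₂) ∧
    (¬ ∃ j : Fin τ.length, i₂ < j ∧ j < i₃ ∧ τ.get j < τ.get i₁) ∧
    (¬ ∃ j : Fin τ.length, i₂ < j ∧ j < i₃ ∧ τ.get i₁ < τ.get j ∧ τ.get j < τ.get i₃)

structure StkModel (f : ℕ → ℕ) (I : ℕ → ℕ → Prop) : Prop where
  inj : ∀ i j, f i = f j → i = j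
  self : ∀ k, I k k
  step : ∀ i k, i ≤ k → I i (k+1) → I i k
  down : ∀ a i k, I a k → I i (k+1) → a < i → i ≤ k → I a (k+1)
  av : ∀ i j l k, I i k → I j k → I l k → i < j → j < l → f l < f i → f i < f j → False
  pop : ∀ i k, I i k → ¬ I i (k+1) →
    ∃ a b, a < b ∧ b ≤ i ∧ I a k ∧ I b k ∧ f (k+1) < f a ∧ f a < f b

namespace StkModel
variable {f : ℕ → ℕ} {I : ℕ → ℕ → Prop}

theorem mono (M : StkModel f I) {i j k : ℕ} (hij : i ≤ j) (hjk : j ≤ k) (h : I i k) : I i j := by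
  induction k, hjk using Nat.le_induction with
  | base => exact h
  | succ k hk ih => exact ih (M.step i k (by omega) h)

theorem lost (M : StkModel f I) {i k : ℕ} (hik : i ≤ k) (h : ¬ I i k) :
    ∃ w, i ≤ w ∧ w < k ∧ I i w ∧ ¬ I i (w+1) := by
  induction k, hik using Nat.le_induction with
  | base => exact absurd (M.self i) h
  | succ k hk ih =>
    by_cases hk' : I i k
    · exact ⟨k, hk, by omega, hk', h⟩
    · obtain ⟨w, h1, h2, h3⟩ := ih hk'
      exact ⟨w, h1, by omega, h3⟩

theorem down' (M : StkModel f I) {a i j k : ℕ} (ha : I a j) (hi : I i k) (h1 : a < i) (h2 : i ≤ j)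
    (h3 : j ≤ k) : I a k := by
  induction k, h3 using Nat.le_induction with
  | base => exact ha
  | succ k hk ih => exact M.down a i k (ih (M.step i k (by omega) hi)) hi h1 (by omega)

/-- popping. -/
theorem pops (M : StkModel f I) {m i w k : ℕ} (hi : I i k) (hm : I m i) (h1 : m < i) (h2 : i < w)
    (h3 : w ≤ k) (h4 : f w < f m) (h5 : f m < f i) : False := by
  have hiw : I i w := M.mono h2.le h3 hi
  exact M.av m i w w (M.down' hm hiw h1 le_rfl h2.le) hiw (M.self w) h1 h2 h4 h5

/-- if lost, there is a 231 with the middle term being the lost one. -/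
theorem lost' (M : StkModel f I) {i k : ℕ} (hik : i ≤ k) (h : ¬ I i k) :
    ∃ w a, a < i ∧ i < w ∧ w ≤ k ∧ I a i ∧ f w < f a ∧ f a < f i := by
  obtain ⟨w, h1, h2, h3, h4⟩ := M.lost hik h
  obtain ⟨a, b, hab, hb, ha, hb', h5, h6⟩ := M.pop i w h3 h4
  refine ⟨w+1, a, by omega, by omega, by omega,
    M.mono (by omega) h1 ha, h5, ?_⟩
  rcases hb.eq_or_lt with rfl | hb
  · exact h6
  · by_contra hc
    have : f a ≠ f i := fun hh => by have := M.inj _ _ hh; omega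
    exact M.av a b i w ha hb' h3 hab hb (by omega) h6

theorem minIn (M : StkModel f I) {m k : ℕ} (hm : ∀ j < m, f m < f j) (hk : m ≤ k) : I m k := by
  by_contra h
  obtain ⟨w, a, h1, h2, h3, h4, h5, h6⟩ := M.lost' hk h
  have := hm a h1
  omega

theorem exMin (M : StkModel f I) (j : ℕ) : ∃ m ≤ j, f m ≤ f j ∧ ∀ i < m, f m < f i := by
  induction j using Nat.strong_induction_on with
  | _ j ih =>
    by_cases h : ∀ i < j, f j < f i
    · exact ⟨j, le_rfl, le_rfl, h⟩
    · push Not at h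
      obtain ⟨i, hi, hij⟩ := h
      obtain ⟨m, h1, h2, h3⟩ := ih i hi
      exact ⟨m, by omega, by omega, h3⟩

/-- output order -/
def R (I : ℕ → ℕ → Prop) (i j : ℕ) : Prop := (i < j ∧ ¬ I i j) ∨ (j < i ∧ I j i)

def CA (n : ℕ) (f : ℕ → ℕ) (I : ℕ → ℕ → Prop) : Prop :=
  ∀ m u v, m < u → u < v → v < n → f m < f u → f u < f v → I u v

def CB (n : ℕ) (f : ℕ → ℕ) (I : ℕ → ℕ → Prop) : Prop :=
  ∀ m m' v u, m < v → v < u → u < n → f m < f v → f u < f v → m' < u → f m' < f u → ¬ I v u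

theorem out_of_not_CA (M : StkModel f I) {n : ℕ} (h : ¬ CA n f I) :
    ∃ i j l, i < n ∧ j < n ∧ l < n ∧ R I i j ∧ R I j l ∧ f l < f i ∧ f i < f j := by
  unfold CA at h
  push Not at h
  obtain ⟨m, u, v, h1, h2, h3, h4, h5, h6⟩ := h
  obtain ⟨m', g1, g2, g3⟩ := M.exMin m
  exact ⟨u, v, m', by omega, h3, by omega, Or.inl ⟨h2, h6⟩, 
    Or.inr ⟨by omega, M.minIn g3 (by omega)⟩, by omega, h5⟩

theorem out_of_not_CB (M : StkModel f I) {n : ℕ} (h : ¬ CB n f I) :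
    ∃ i j l, i < n ∧ j < n ∧ l < n ∧ R I i j ∧ R I j l ∧ f l < f i ∧ f i < f j := by
  unfold CB at h
  push Not at h
  obtain ⟨m, m', v, u, h1, h2, h3, h4, h5, h6, h7, h8⟩ := h
  obtain ⟨a, a1, a2, a3⟩ := M.exMin m
  obtain ⟨b, b1, b2, b3⟩ := M.exMin m'
  have key : ∃ c < v, f c < f u ∧ ∀ i < c, f c < f i := by
    by_cases hbv : b < v
    · exact ⟨b, hbv, by omega, b3⟩
    · by_cases hau : f a < f u
      · exact ⟨a, by omega, hau, a3⟩
      · exfalso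
        have hbv' : b ≠ v := by rintro rfl; omega
        exact M.pops (m := a) (i := v) (w := b) h8 (M.minIn a3 (by omega)) (by omega) (by omega)
          (by omega) (by omega) (by omega)
  obtain ⟨c, c1, c2, c3⟩ := key
  exact ⟨u, v, c, by omega, by omega, by omega, Or.inr ⟨h2, h8⟩,
    Or.inr ⟨by omega, M.minIn c3 (by omega)⟩, c2, h5⟩

theorem out_avoid (M : StkModel f I) {n : ℕ} (hA : CA n f I) (hB : CB n f I) {i j l : ℕ}
    (hi : i < n) (hj : j < n) (hij : R I i j) (hjl : R I j l)
    (h1 : f l < f i) (h2 : f i < f j) : False := by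
  rcases hij with ⟨hlt, hn⟩ | ⟨hlt, hin⟩
  · by_cases hm : ∃ m < i, f m < f i
    · obtain ⟨m, hm1, hm2⟩ := hm
      exact hn (hA m i j hm1 hlt hj hm2 h2)
    · push Not at hm
      refine hn (M.minIn (fun a ha => lt_of_le_of_ne (hm a ha) fun hh => ?_) hlt.le)
      have := M.inj _ _ hh
      omega
  · by_cases hm : ∃ m < j, f m < f j
    · obtain ⟨m, hm1, hm2⟩ := hm
      by_cases hm' : ∃ m' < i, f m' < f i
      · obtain ⟨m', g1, g2⟩ := hm'
        exact hB m m' j i hm1 hlt hi hm2 h2 g1 g2 hin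
      · push Not at hm'
        obtain ⟨a, a1, a2, a3⟩ := M.exMin m
        have := hm' a (by omega)
        have : f a ≠ f i := fun hh => by have := M.inj _ _ hh; omega
        exact M.pops (m := a) (i := j) (w := i) hin (M.minIn a3 (by omega)) (by omega) hlt le_rfl
          (by omega) (by omega)
    · push Not at hm
      rcases hjl with ⟨k1, k2⟩ | ⟨k1, k2⟩
      · refine k2 (M.minIn (fun a ha => lt_of_le_of_ne (hm a ha) fun hh => ?_) k1.le)
        have := M.inj _ _ hh
        omega
      · have := hm l k1
        omega

def C2314 (n : ℕ) (f : ℕ → ℕ) : Prop :=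
  ∃ b c w v, b < c ∧ c < w ∧ w < v ∧ v < n ∧ f w < f b ∧ f b < f c ∧ f c < f v

def Mesh (f : ℕ → ℕ) (a c b : ℕ) : Prop :=
  a < c ∧ c < b ∧ f a < f b ∧ f b < f c ∧ (∀ j < a, f b < f j → f j < f c → False) ∧
    (∀ j, c < j → j < b → f j < f b → False)

def CMu (n : ℕ) (f : ℕ → ℕ) : Prop := ∃ a c b, b < n ∧ Mesh f a c b

theorem not_C2314 (M : StkModel f I) {n : ℕ} (hA : CA n f I) (hB : CB n f I) : ¬ C2314 n f := by
  rintro ⟨b, c, w, v, h1, h2, h3, h4, h5, h6, h7⟩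
  have hcv : I c v := hA b c v h1 (by omega) h4 h6 h7
  obtain ⟨m, m1, m2, m3⟩ := M.exMin b
  by_cases hw : f w < f m
  · exact M.pops hcv (M.minIn m3 (by omega)) (by omega) h2 h3.le hw (by omega)
  · have hmw : f m ≠ f w := fun hh => by have := M.inj _ _ hh; omega
    have hmb : m ≠ b := by rintro rfl; omega
    have hbc : I b c := hA m b c (by omega) h1 (by omega) (by omega) h6
    exact M.pops hcv hbc h1 h2 h3.le h5 h6

theorem not_mesh (M : StkModel f I) {n : ℕ} (hB : CB n f I) (a c b : ℕ) (hbn : b < n) :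
    ¬ Mesh f a c b := by
  induction c using Nat.strong_induction_on with
  | _ c ih =>
    rintro ⟨h1, h2, h3, h4, h5, h6⟩
    have hcb : ¬ I c b := hB a a c b h1 h2 hbn (by omega) h4 (by omega) h3
    obtain ⟨w, p, k1, k2, k3, k4, k5, k6⟩ := M.lost' h2.le hcb
    have hwb : f b ≤ f w := by
      by_contra hc
      have : w ≠ b := by rintro rfl; omega
      exact h6 w k2 (by omega) (by omega)
    have hpa : a < p := by
      by_contra hc
      have : p ≠ a := by rintro rfl; omega
      exact h5 p (by omega) (by omega) k6
    refine ih p k1 ⟨hpa, by omega, h3, by omega, fun j g1 g2 g3 => h5 j g1 g2 (by omega), ?_⟩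
    intro j g1 g2 g3
    rcases lt_trichotomy j c with g | g | g
    · by_cases hj : ∃ m' < j, f m' < f j
      · obtain ⟨m', e1, e2⟩ := hj
        exact hB a m' p j hpa g1 (by omega) (by omega) (by omega) e1 e2 (M.mono g1.le g.le k4)
      · push Not at hj
        obtain ⟨m, m1, m2, m3⟩ := M.exMin a
        have := hj m (by omega)
        have : f m ≠ f j := fun hh => by have := M.inj _ _ hh; omega
        exact M.pops k4 (M.minIn m3 (by omega)) (by omega) g1 g.le (by omega) (by omega)
    · subst g; omega
    · exact h6 j g g2 g3

theorem CA_of (M : StkModel f I) {n : ℕ} (h : ¬ C2314 n f) : CA n f I := by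
  intro m u v h1 h2 h3 h4 h5
  by_contra hc
  obtain ⟨w, a, k1, k2, k3, k4, k5, k6⟩ := M.lost' h2.le hc
  have : w ≠ v := by rintro rfl; omega
  exact h ⟨a, u, w, v, k1, k2, by omega, h3, k5, k6, h5⟩

theorem CB_of (M : StkModel f I) {n : ℕ} (h : ¬ CMu n f) : CB n f I := by
  intro m m' v u
  induction u using Nat.strong_induction_on generalizing m' with
  | _ u ih =>
    intro h1 h2 h3 h4 h5 h6 h7 hI
    obtain ⟨q, q1, q2, q3⟩ := M.exMin m
    -- `u` may be taken first
    by_cases hf : ∃ j, v < j ∧ j < u ∧ f j < f u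
    · obtain ⟨j, j1, j2, j3⟩ := hf
      by_cases hj : ∃ m' < j, f m' < f j
      · obtain ⟨m'', e1, e2⟩ := hj
        exact ih j j2 m'' h1 j1 (by omega) h4 (by omega) e1 e2 (M.mono j1.le j2.le hI)
      · push Not at hj
        have := hj q (by omega)
        have : f q ≠ f j := fun hh => by have := M.inj _ _ hh; omega
        exact M.pops hI (M.minIn q3 (by omega)) (by omega) j1 j2.le (by omega) (by omega)
    · push Not at hf
      have hm'v : m' < v := by
        by_contra hc
        have : m' ≠ v := by rintro rfl; omega
        have := hf m' (by omega) h6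
        omega
      have hex : ∃ a, f a < f u := ⟨m', h7⟩
      classical
      have ha := Nat.find_spec hex
      have ha' : ∀ j < Nat.find hex, f u ≤ f j := fun j hj => by
        have := Nat.find_min hex hj
        omega
      have hle : Nat.find hex ≤ m' := Nat.find_min' hex h7
      generalize Nat.find hex = a at ha ha' hle
      refine h ⟨a, v, u, h3, by omega, h2, ha, h5, ?_, fun j g1 g2 g3 => ?_⟩
      · intro j g1 g2 g3
        obtain ⟨p, p1, p2, p3⟩ := M.exMin j
        have := ha' p (by omega)
        have : f p ≠ f u := fun hh => by have := M.inj _ _ hh; omega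
        exact M.pops hI (M.minIn p3 (by omega)) (by omega) h2 le_rfl (by omega) (by omega)
      · have := hf j g1 g2
        omega

theorem main (M : StkModel f I) (n : ℕ) :
    (¬ ∃ i j l, i < n ∧ j < n ∧ l < n ∧ R I i j ∧ R I j l ∧ f l < f i ∧ f i < f j) ↔
      ¬ C2314 n f ∧ ¬ CMu n f := by
  constructor
  · intro h
    have hA : CA n f I := by
      by_contra hc
      exact h (M.out_of_not_CA hc)
    have hB : CB n f I := by
      by_contra hc
      exact h (M.out_of_not_CB hc)
    refine ⟨M.not_C2314 hA hB, ?_⟩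
    rintro ⟨a, c, b, hb, hm⟩
    exact M.not_mesh hB a c b hb hm
  · rintro ⟨h1, h2⟩ ⟨i, j, l, hi, hj, hl, hij, hjl, e1, e2⟩
    exact M.out_avoid (M.CA_of h1) (M.CB_of h2) hi hj hij hjl e1 e2

end StkModel

def Bad (f : ℕ → ℕ) (k : ℕ) (s : List ℕ) : Prop :=
  ∃ b ∈ s, ∃ a ∈ s, a < b ∧ f k < f a ∧ f a < f b

open Classical in
noncomputable def keepS (f : ℕ → ℕ) (k : ℕ) : List ℕ → List ℕ
  | [] => []
  | y :: s => if Bad f k (y :: s) then keepS f k s else y :: s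

open Classical in
noncomputable def popS (f : ℕ → ℕ) (k : ℕ) : List ℕ → List ℕ
  | [] => []
  | y :: s => if Bad f k (y :: s) then y :: popS f k s else []

noncomputable def stk (f : ℕ → ℕ) : ℕ → List ℕ
  | 0 => []
  | k + 1 => k :: keepS f k (stk f k)

noncomputable def outp (f : ℕ → ℕ) : ℕ → List ℕ
  | 0 => []
  | k + 1 => outp f k ++ popS f k (stk f k)

theorem pop_append_keep (f : ℕ → ℕ) (k : ℕ) (s : List ℕ) : popS f k s ++ keepS f k s = s := by
  induction s with
  | nil => rfl
  | cons y s ih => 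
    unfold popS keepS
    split_ifs <;> simp [ih]

theorem keep_not_bad (f : ℕ → ℕ) (k : ℕ) (s : List ℕ) : ¬ Bad f k (keepS f k s) := by
  induction s with
  | nil => simp [keepS, Bad]
  | cons y s ih =>
    unfold keepS
    split_ifs with h
    · exact ih
    · exact h

theorem keep_sub {f : ℕ → ℕ} {k : ℕ} {s : List ℕ} {x : ℕ} (h : x ∈ keepS f k s) : x ∈ s := by
  rw [← pop_append_keep f k s]
  exact List.mem_append_right _ h

theorem stk_sorted (f : ℕ → ℕ) (k : ℕ) : (stk f k).Pairwise (· > ·) ∧ ∀ x ∈ stk f k, x < k := by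
  induction k with
  | zero => simp [stk]
  | succ k ih =>
    have h1 : (keepS f k (stk f k)).Pairwise (· > ·) := by
      have := ih.1
      rw [← pop_append_keep f k (stk f k)] at this
      exact (List.pairwise_append.1 this).2.1
    refine ⟨?_, ?_⟩
    · rw [stk, List.pairwise_cons]
      exact ⟨fun x hx => ih.2 x (keep_sub hx), h1⟩
    · intro x hx
      rw [stk, List.mem_cons] at hx
      rcases hx with rfl | hx
      · omega
      · have := ih.2 x (keep_sub hx)
        omega

theorem pop_bad {f : ℕ → ℕ} {k : ℕ} {s : List ℕ} (hs : s.Pairwise (· > ·)) {x : ℕ}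
    (hx : x ∈ s) (hx' : x ∉ keepS f k s) : 
    ∃ b ∈ s, ∃ a ∈ s, a < b ∧ b ≤ x ∧ f k < f a ∧ f a < f b := by
  induction s with
  | nil => simp at hx
  | cons y s ih =>
    rw [List.pairwise_cons] at hs
    unfold keepS at hx'
    split_ifs at hx' with h
    · rcases List.mem_cons.1 hx with rfl | hx
      · obtain ⟨b, hb, a, ha, h1, h2, h3⟩ := h
        refine ⟨b, hb, a, ha, h1, ?_, h2, h3⟩
        rcases List.mem_cons.1 hb with rfl | hb
        · exact le_rfl
        · exact (hs.1 b hb).le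
      · obtain ⟨b, hb, a, ha, h1⟩ := ih hs.2 hx hx'
        exact ⟨b, by simp [hb], a, by simp [ha], h1⟩
    · exact absurd hx hx'

theorem keep_down {f : ℕ → ℕ} {k : ℕ} {s : List ℕ} (hs : s.Pairwise (· > ·)) {x a : ℕ}
    (hx : x ∈ keepS f k s) (ha : a ∈ s) (hax : a < x) : a ∈ keepS f k s := by
  rw [← pop_append_keep f k s] at hs ha
  rcases List.mem_append.1 ha with h | h
  · have := (List.pairwise_append.1 hs).2.2 a h x hx
    omega
  · exact h

def StAv (f : ℕ → ℕ) (s : List ℕ) : Prop :=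
  ∀ i ∈ s, ∀ j ∈ s, ∀ l ∈ s, i < j → j < l → f l < f i → f i < f j → False

theorem stk_av (f : ℕ → ℕ) (k : ℕ) : StAv f (stk f k) := by
  induction k with
  | zero => simp [stk, StAv]
  | succ k ih =>
    intro i hi j hj l hl h1 h2 h3 h4
    rw [stk, List.mem_cons] at hi hj hl
    have hlt := (stk_sorted f k).2
    have hlk : l ≤ k := by
      rcases hl with rfl | hl
      · exact le_rfl
      · exact (hlt l (keep_sub hl)).le
    have hi' : i ∈ keepS f k (stk f k) := by
      rcases hi with rfl | hi
      · omega
      · exact hi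
    have hj' : j ∈ keepS f k (stk f k) := by
      rcases hj with rfl | hj
      · omega
      · exact hj
    rcases hl with rfl | hl
    · exact keep_not_bad f l _ ⟨j, hj', i, hi', h1, h3, h4⟩
    · exact ih i (keep_sub hi') j (keep_sub hj') l (keep_sub hl) h1 h2 h3 h4

def InS (f : ℕ → ℕ) (i k : ℕ) : Prop := i ∈ stk f (k + 1)

theorem model {f : ℕ → ℕ} (hf : ∀ i j, f i = f j → i = j) : StkModel f (InS f) where
  inj := hf
  self k := by simp [InS, stk]
  step i k h h' := by
    unfold InS at *
    rw [stk, List.mem_cons] at h'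
    rcases h' with h' | h'
    · omega
    · exact keep_sub h'
  down a i k ha hi h1 h2 := by
    unfold InS at *
    rw [stk, List.mem_cons] at hi ⊢
    rcases hi with hi | hi
    · omega
    · exact Or.inr (keep_down (stk_sorted f _).1 hi ha h1)
  av i j l k h1 h2 h3 := stk_av f (k+1) i h1 j h2 l h3
  pop i k h h' := by
    unfold InS at *
    rw [stk, List.mem_cons, not_or] at h'
    obtain ⟨b, hb, a, ha, h1, h2, h3⟩ := pop_bad (stk_sorted f _).1 h h'.2
    exact ⟨a, b, h1, h2, ha, hb, h3⟩

theorem R_irrefl (I : ℕ → ℕ → Prop) (i : ℕ) : ¬ StkModel.R I i i := by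
  unfold StkModel.R; omega

theorem R_asymm (I : ℕ → ℕ → Prop) {i j : ℕ} (h : StkModel.R I i j) : ¬ StkModel.R I j i := by
  rintro h'
  rcases h with ⟨a, b⟩ | ⟨a, b⟩ <;> rcases h' with ⟨c, d⟩ | ⟨c, d⟩
  · omega
  · exact b d
  · exact d b
  · omega

theorem out_inv (f : ℕ → ℕ) (k : ℕ) :
    (outp f k ++ stk f k).Pairwise (StkModel.R (InS f)) ∧ ∀ x, x ∈ outp f k ++ stk f k ↔ x < k := by
  induction k with
  | zero => simp [outp, stk]
  | succ k ih =>
    obtain ⟨h1, h2⟩ := ih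
    have e : outp f k ++ stk f k = outp f (k+1) ++ keepS f k (stk f k) := by
      rw [outp, List.append_assoc, pop_append_keep]
    rw [e] at h1 h2
    rw [List.pairwise_append] at h1
    obtain ⟨g1, g2, g3⟩ := h1
    refine ⟨?_, ?_⟩
    · rw [List.pairwise_append]
      refine ⟨g1, ?_, ?_⟩
      · rw [stk, List.pairwise_cons]
        refine ⟨fun x hx => Or.inr ⟨(h2 x).1 (List.mem_append_right _ hx), ?_⟩, g2⟩
        simp [InS, stk, hx]
      · intro x hx y hy
        rw [stk, List.mem_cons] at hy
        rcases hy with rfl | hy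
        · have hlt := (h2 x).1 (List.mem_append_left _ hx)
          refine Or.inl ⟨hlt, ?_⟩
          intro hI
          rw [InS, stk, List.mem_cons] at hI
          rcases hI with hI | hI
          · omega
          · exact R_irrefl _ _ (g3 x hx x hI)
        · exact g3 x hx y hy
    · intro x
      have := h2 x
      simp only [List.mem_append] at this
      simp only [stk, List.mem_append, List.mem_cons]
      have : x < k + 1 ↔ x < k ∨ x = k := by omega
      tauto

theorem containsV_132 (l : List ℕ) : ContainsV [1,3,2] {0} l ↔
    ∃ i j, ∃ (_ : i + 1 < j) (_ : j < l.length), l[i] < l[j] ∧ l[j] < l[i+1] := by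
  constructor
  · rintro ⟨f, h1, h2, h3⟩
    have e := h3 0 rfl (by simp)
    have a1 : f 1 < f 2 := h1 (by decide)
    have c1 := (h2 0 2).1 (by decide)
    have c2 := (h2 2 1).1 (by decide)
    have e' : (f 1 : ℕ) = (f 0 : ℕ) + 1 := e
    refine ⟨f 0, f 2, by rw [← e']; exact a1, (f 2).2, c1, ?_⟩
    simp only [← e']
    exact c2
  · rintro ⟨i, j, h1, h2, h3, h4⟩
    refine ⟨![⟨i, by omega⟩, ⟨i+1, by omega⟩, ⟨j, h2⟩], ?_, ?_, ?_⟩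
    · intro a b hab
      fin_cases a <;> fin_cases b <;> simp [Fin.lt_def] at hab ⊢ <;> omega
    · intro a b
      fin_cases a <;> fin_cases b <;> simp <;> omega
    · intro a ha h
      obtain rfl : a = 0 := ha
      rfl

theorem containsV_231_s12 (l : List ℕ) : ContainsV [2,3,1] ∅ l ↔
    ∃ i j k, ∃ (_ : i < j) (_ : j < k) (_ : k < l.length), l[k] < l[i] ∧ l[i] < l[j] := by
  constructor
  · rintro ⟨f, h1, h2, h3⟩
    have a0 : f 0 < f 1 := h1 (by decide)
    have a1 : f 1 < f 2 := h1 (by decide)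
    have c1 := (h2 2 0).1 (by decide)
    have c2 := (h2 0 1).1 (by decide)
    exact ⟨f 0, f 1, f 2, a0, a1, (f 2).2, c1, c2⟩
  · rintro ⟨i, j, k, h1, h2, h, h3, h4⟩
    refine ⟨![⟨i, by omega⟩, ⟨j, by omega⟩, ⟨k, h⟩], ?_, ?_, ?_⟩
    · intro a b hab
      fin_cases a <;> fin_cases b <;> simp [Fin.lt_def] at hab ⊢ <;> omega
    · intro a b
      fin_cases a <;> fin_cases b <;> simp <;> omega
    · intro a ha
      exact absurd ha (Set.notMem_empty a)

theorem containsV_2314 (l : List ℕ) : ContainsV [2,3,1,4] ∅ l ↔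
    ∃ i j k m, ∃ (_ : i < j) (_ : j < k) (_ : k < m) (_ : m < l.length),
      l[k] < l[i] ∧ l[i] < l[j] ∧ l[j] < l[m] := by
  constructor
  · rintro ⟨f, h1, h2, h3⟩
    have a0 : f 0 < f 1 := h1 (by decide)
    have a1 : f 1 < f 2 := h1 (by decide)
    have a2 : f 2 < f 3 := h1 (by decide)
    have c1 := (h2 2 0).1 (by decide)
    have c2 := (h2 0 1).1 (by decide)
    have c3 := (h2 1 3).1 (by decide)
    exact ⟨f 0, f 1, f 2, f 3, a0, a1, a2, (f 3).2, c1, c2, c3⟩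
  · rintro ⟨i, j, k, m, h1, h2, h5, h, h3, h4, h6⟩
    refine ⟨![⟨i, by omega⟩, ⟨j, by omega⟩, ⟨k, by omega⟩, ⟨m, h⟩], ?_, ?_, ?_⟩
    · intro a b hab
      fin_cases a <;> fin_cases b <;> simp [Fin.lt_def] at hab ⊢ <;> omega
    · intro a b
      fin_cases a <;> fin_cases b <;> simp <;> omega
    · intro a ha
      exact absurd ha (Set.notMem_empty a)

theorem contains_iff_bad {f : ℕ → ℕ} (hf : ∀ i j, f i = f j → i = j) {k y : ℕ} {s : List ℕ}
    (hs : (y :: s).Pairwise (· > ·)) (hav : StAv f (y :: s)) :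
    ContainsV [1,3,2] {0} (f k :: f y :: s.map f) ↔ Bad f k (y :: s) := by
  rw [containsV_132]
  constructor
  · rintro ⟨i, j, h1, h2, h3, h4⟩
    obtain ⟨j, rfl⟩ : ∃ j', j = j' + 2 := ⟨j - 2, by omega⟩
    have hj : j < s.length := by simpa using h2
    rcases i with _ | i
    · simp at h3 h4
      refine ⟨y, by simp, s[j], by simp, ?_, h3, h4⟩
      exact (List.pairwise_cons.1 hs).1 _ (by simp)
    · exfalso
      rw [List.pairwise_iff_getElem] at hs
      have e1 := hs i (i+1) (by simp; omega) (by simp; omega) (by omega)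
      have e2 := hs (i+1) (j+1) (by simp; omega) (by simp; omega) (by omega)
      have t : f y :: s.map f = (y :: s).map f := rfl
      simp only [t, List.getElem_cons_succ, List.getElem_map] at h3 h4
      have hl : j + 1 < (y :: s).length := by simp; omega
      refine hav (y :: s)[j+1] (List.getElem_mem _) (y :: s)[i+1] (List.getElem_mem _)
        (y :: s)[i] (List.getElem_mem _) e2 e1 ?_ ?_
      · simpa using h3
      · simpa using h4
  · rintro ⟨b, hb, a, ha, h1, h2, h3⟩
    have hlt := (List.pairwise_cons.1 hs).1
    have hby : b ≤ y := by
      rcases List.mem_cons.1 hb with rfl | hb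
      · exact le_rfl
      · exact (hlt b hb).le
    have ha' : a ∈ s := by
      rcases List.mem_cons.1 ha with rfl | ha
      · omega
      · exact ha
    have hay : f a < f y := by
      rcases hby.eq_or_lt with rfl | hby
      · exact h3
      · by_contra hc
        have : f a ≠ f y := fun hh => by have := hf _ _ hh; omega
        exact hav a ha b hb y (by simp) h1 hby (by omega) h3
    obtain ⟨j, hj, rfl⟩ := List.getElem_of_mem ha'
    exact ⟨0, j+2, by omega, by simpa using hj, by simpa using h2, by simpa using hay⟩

theorem scAux_push {f : ℕ → ℕ} (hf : ∀ i j, f i = f j → i = j) {k : ℕ} (rest : List ℕ) {s : List ℕ}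
    (hs : s.Pairwise (· > ·)) (hav : StAv f s) :
    scAux [1,3,2] {0} (s.map f) (f k :: rest) =
      (popS f k s).map f ++ scAux [1,3,2] {0} (f k :: (keepS f k s).map f) rest := by
  induction s with
  | nil => simp [popS, keepS, scAux]
  | cons y s ih =>
    have hb := contains_iff_bad hf (k := k) hs hav
    rw [List.map_cons, scAux]
    by_cases h : Bad f k (y :: s)
    · rw [if_pos (hb.2 h)]
      rw [ih (List.pairwise_cons.1 hs).2 (fun i hi j hj l hl => hav i (by simp [hi]) j (by simp [hj])
        l (by simp [hl]))]
      simp [popS, keepS, h]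
    · rw [if_neg (fun hh => h (hb.1 hh))]
      simp [popS, keepS, h]

theorem sc_eq {f : ℕ → ℕ} (hf : ∀ i j, f i = f j → i = j) (τ : List ℕ)
    (hτ : ∀ i (h : i < τ.length), τ[i] = f i) (k : ℕ) (hk : k ≤ τ.length) :
    sc [1,3,2] {0} τ = (outp f k).map f ++ scAux [1,3,2] {0} ((stk f k).map f) (τ.drop k) := by
  induction k with
  | zero => simp [sc, outp, stk]
  | succ k ih =>
    rw [ih (by omega), List.drop_eq_getElem_cons (by omega), hτ k (by omega),
      scAux_push hf _ (stk_sorted f k).1 (stk_av f k)]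
    simp [outp, stk]

theorem sc_eq' {f : ℕ → ℕ} (hf : ∀ i j, f i = f j → i = j) (τ : List ℕ)
    (hτ : ∀ i (h : i < τ.length), τ[i] = f i) :
    sc [1,3,2] {0} τ = (outp f τ.length ++ stk f τ.length).map f := by
  rw [sc_eq hf τ hτ τ.length le_rfl]
  simp [scAux]

theorem key {f : ℕ → ℕ} (hf : ∀ i j, f i = f j → i = j) (τ : List ℕ)
    (hτ : ∀ i (h : i < τ.length), τ[i] = f i) :
    ¬ ContainsV [2,3,1] ∅ (sc [1,3,2] {0} τ) ↔
      ¬ ContainsV [2,3,1,4] ∅ τ ∧ ¬ ContainsMu132 τ := by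
  have e1 : ContainsV [2,3,1] ∅ (sc [1,3,2] {0} τ) ↔ ∃ i j l, i < τ.length ∧ j < τ.length ∧
      l < τ.length ∧ StkModel.R (InS f) i j ∧ StkModel.R (InS f) j l ∧ f l < f i ∧ f i < f j := by
    rw [sc_eq' hf τ hτ, containsV_231_s12]
    obtain ⟨h1, h2⟩ := out_inv f τ.length
    generalize outp f τ.length ++ stk f τ.length = O at h1 h2
    rw [List.pairwise_iff_getElem] at h1
    constructor
    · rintro ⟨i, j, k, g1, g2, g3, g4, g5⟩
      have g3' : k < O.length := by simpa using g3
      simp only [List.getElem_map] at g4 g5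
      exact ⟨O[i], O[j], O[k], (h2 _).1 (List.getElem_mem _), (h2 _).1 (List.getElem_mem _),
        (h2 _).1 (List.getElem_mem _), h1 _ _ _ _ g1, h1 _ _ _ _ g2, g4, g5⟩
    · rintro ⟨i, j, l, hi, hj, hl, hij, hjl, g1, g2⟩
      obtain ⟨a, ha, rfl⟩ := List.getElem_of_mem ((h2 i).2 hi)
      obtain ⟨b, hb, rfl⟩ := List.getElem_of_mem ((h2 j).2 hj)
      obtain ⟨c, hc, rfl⟩ := List.getElem_of_mem ((h2 l).2 hl)
      have aux : ∀ x y (hx : x < O.length) (hy : y < O.length),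
          StkModel.R (InS f) O[x] O[y] → x < y := by
        intro x y hx hy h
        rcases lt_trichotomy x y with g | g | g
        · exact g
        · subst g
          exact absurd h (R_irrefl _ _)
        · exact absurd (h1 y x hy hx g) (R_asymm _ h)
      exact ⟨a, b, c, aux _ _ _ _ hij, aux _ _ _ _ hjl, by simpa using hc, by simpa using g1,
        by simpa using g2⟩
  have e2 : ContainsV [2,3,1,4] ∅ τ ↔ StkModel.C2314 τ.length f := by
    rw [containsV_2314]
    constructor
    · rintro ⟨i, j, k, m, a1, a2, a3, a4, a5, a6, a7⟩
      simp only [hτ] at a5 a6 a7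
      exact ⟨i, j, k, m, a1, a2, a3, a4, a5, a6, a7⟩
    · rintro ⟨i, j, k, m, a1, a2, a3, a4, a5, a6, a7⟩
      refine ⟨i, j, k, m, a1, a2, a3, a4, ?_⟩
      simp only [hτ]
      exact ⟨a5, a6, a7⟩
  have e3 : ContainsMu132 τ ↔ StkModel.CMu τ.length f := by
    unfold ContainsMu132 StkModel.CMu StkModel.Mesh
    simp only [List.get_eq_getElem, hτ]
    constructor
    · rintro ⟨a, c, b, h1, h2, h3, h4, h5, h6, h7⟩
      refine ⟨a, c, b, b.2, h1, h2, h3, h4, fun j g1 g2 g3 => h5 ⟨⟨j, by omega⟩, g1, g2, g3⟩, ?_⟩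
      intro j g1 g2 g3
      rcases lt_trichotomy (f j) (f a) with g | g | g
      · exact h6 ⟨⟨j, by omega⟩, g1, g2, g⟩
      · have := hf _ _ g
        have : (a : ℕ) < c := h1
        omega
      · exact h7 ⟨⟨j, by omega⟩, g1, g2, g, g3⟩
    · rintro ⟨a, c, b, hb, h1, h2, h3, h4, h5, h6⟩
      refine ⟨⟨a, by omega⟩, ⟨c, by omega⟩, ⟨b, hb⟩, h1, h2, h3, h4, ?_, ?_, ?_⟩
      · rintro ⟨j, g1, g2, g3⟩
        exact h5 j g1 g2 g3
      · rintro ⟨j, g1, g2, g3⟩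
        exact h6 j g1 g2 (lt_trans g3 h3)
      · rintro ⟨j, g1, g2, g3, g4⟩
        exact h6 j g1 g2 g4
  rw [e1, e2, e3]
  exact (model hf).main τ.length

/-- Sort_n(sc_{\un{13}2}) = Av_n(2314, μ_{132}). -/
theorem sortingClass_un132 (n : ℕ) :
    SortSet [1, 3, 2] {0} n =
      {τ | IsPermList n τ ∧ ¬ ContainsV [2, 3, 1, 4] ∅ τ ∧ ¬ ContainsMu132 τ} := by
  ext τ
  simp only [SortSet, Set.mem_setOf_eq]
  refine and_congr_right fun hp => ?_
  have hnd : τ.Nodup := hp.nodup_iff.2 List.nodup_range'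
  have hle : ∀ x ∈ τ, x ≤ n := fun x hx => by
    have := hp.mem_iff.1 hx
    rw [List.mem_range'_1] at this
    omega
  refine key (f := fun i => τ.getD i (n + 1 + i)) ?_ τ ?_
  · intro i j h
    by_cases hi : i < τ.length <;> by_cases hj : j < τ.length
    · simp only [List.getD_eq_getElem _ _ hi, List.getD_eq_getElem _ _ hj] at h
      exact (hnd.getElem_inj_iff).1 h
    · have := hle _ (List.getElem_mem hi)
      simp only [List.getD_eq_getElem _ _ hi, List.getD_eq_default _ _ (not_lt.1 hj)] at h
      omega
    · have := hle _ (List.getElem_mem hj)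
      simp only [List.getD_eq_getElem _ _ hj, List.getD_eq_default _ _ (not_lt.1 hi)] at h
      omega
    · simp only [List.getD_eq_default _ _ (not_lt.1 hi),
        List.getD_eq_default _ _ (not_lt.1 hj)] at h
      omega
  · intro i hi
    simp only [List.getD_eq_getElem _ _ hi]
end
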